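/- Let d > 0 be real, n ∈ ℕ, and α₁,…,α₅ ∈ ℂ. Write α_{i…j} for sums of the α's. Assume the pole-separation conditions Re(α₄) − d/4 + n/2 > 0, Re(α₁₄₅) − 3d/4 + n/2 > 0, d/4 − Re(α₃) + n/2 > 0, d/4 + n/2 > 0, 3d/4 − Re(α₄₅) + n/2 > 0, 5d/4 − Re(α₁₂₄₅) + n/2 > 0, the decay condition Re(α₂₃₅) > 1/2, and that none of the Gamma factors below has a pole on the integration contour or at a summation point. Define for ν ∈ ℝ: F_n(ν) = [Γ(d/4 + n/2 − iν)/Γ(d/4 + n/2 + iν)] · [Γ(α₄ − d/4 + n/2 + iν)/Γ(3d/4 − α₄ + n/2 − iν)] · [Γ(3d/4 − α₄₅ + n/2 − iν)/Γ(α₄₅ − d/4 + n/2 + iν)] · [Γ(α₁₄₅ − 3d/4 + n/2 + iν)/Γ(5d/4 − α₁₄₅ + n/2 − iν)] · [Γ(5d/4 − α₁₂₄₅ + n/2 − iν)/Γ(α₁₂₄₅ − 3d/4 + n/2 + iν)] · [Γ(d/4 − α₃ + n/2 + iν)/Γ(α₃ + d/4 + n/2 − iν)]. Then ∫_ℝ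 F_n(ν) dν = 2π (S₁ⁿ + S₂ⁿ + S₃ⁿ), where S₁ⁿ = ∑_{k=0}^{∞} ((−1)^k/k!) · Γ(α₄+n+k)Γ(d/2−α₅+n+k)Γ(α₁₅−d/2−k)Γ(d−α₁₂₅+n+k)Γ(d/2−α₃₄−k) / [Γ(d/2−α₄−k)Γ(α₅−k)Γ(d−α₁₅+n+k)Γ(α₁₂₅−d/2−k)Γ(α₃₄+n+k)Γ(d/2+n+k)], S₂ⁿ = ∑_{k=0}^{∞} ((−1)^k/k!) · Γ(α₁₄₅−d/2+n+k)Γ(d/2−α₁₅−k)Γ(α₁+n+k)Γ(d/2−α₂+n+k)Γ(d−α₁₃₄₅−k) / [Γ(d−α₁₄₅−k)Γ(α₁₅+n+k)Γ(d/2−α₁−k)Γ(α₂−k)Γ(α₁₃₄₅−d/2+n+k)Γ(d/2+n+k)], and S₃ⁿ = ∑_{k=0}^{∞} ((−1)^k/k!) · Γ(d/2−α₃+n+k)Γ(α₃₄−d/2−k)Γ(d−α₃₄₅+n+k)Γ(α₁₃₄₅−d−k)Γ(3d/2−α₁₂₃₄₅+n+k) / [Γ(α₃−k)Γ(d−α₃₄+n+k)Γ(α₃₄₅−d/2−k)Γ(3d/2−α₁₃₄₅+n+k)Γ(α₁₂₃₄₅−d−k)Γ(d/2+n+k)],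 all three series being absolutely convergent under the stated hypotheses. -/

import Mathlib

open Complex MeasureTheory

section Helpers

open Filter Asymptotics Topology Set
open scoped Real

/-! ### Asymptotics of quotients of Gamma functions on the right half-plane -/

lemma Complex.re_add_nonneg_norm_le {w : ℂ} (hw : 0 ≤ w.re) {x : ℝ} (hx : 0 ≤ x) :
    ‖w‖ ^ 2 + x ^ 2 ≤ ‖w + x‖ ^ 2 := by
  rw [Complex.sq_norm, Complex.sq_norm, normSq_apply, normSq_apply]
  simp only [add_re, ofReal_re, add_im, ofReal_im, add_zero]
  nlinarith [mul_nonneg hw hx]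

lemma Complex.log_one_add_inv {z : ℂ} (hz : 0 ≤ z.re) (h0 : z ≠ 0) :
    log (1 + 1 / z) = log (z + 1) - log z := by
  have hre : 0 < (1 + 1 / z).re := by
    have : 0 ≤ (1 / z).re := by
      rw [one_div, inv_re]; exact div_nonneg hz (normSq_nonneg z)
    simp only [add_re, one_re]; linarith
  have hne : 1 + 1 / z ≠ 0 := fun h => by rw [h] at hre; simp at hre
  have h1 : |arg z| ≤ π / 2 := abs_arg_le_pi_div_two_iff.2 hz
  have h2 : |arg (1 + 1 / z)| < π / 2 := abs_arg_lt_pi_div_two_iff.2 (Or.inl hre)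
  rw [abs_le] at h1
  rw [abs_lt] at h2
  have h3 : z * (1 + 1 / z) = z + 1 := by field_simp
  rw [← h3, log_mul h0 hne ⟨by linarith, by linarith⟩]
  ring

/-- The summands in the logarithm of a quotient of Euler products telescope up to `O(|z|⁻²)`. -/
lemma Complex.norm_log_quotient_sub_le {p q z : ℂ} {M : ℝ} (hp : ‖p‖ ≤ M) (hq : ‖q‖ ≤ M)
    (hM : 1 ≤ M) (hz : 2 * M ≤ ‖z‖) :
    ‖log (1 + q / z) - log (1 + p / z) - (q - p) * log (1 + 1 / z)‖ ≤ 4 * M ^ 2 / ‖z‖ ^ 2 := by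
  have hz0 : 0 < ‖z‖ := by linarith
  have key : ∀ u : ℂ, ‖u‖ ≤ M → ‖log (1 + u / z) - u / z‖ ≤ ‖u‖ ^ 2 / ‖z‖ ^ 2 := by
    intro u hu
    have h1 : ‖u / z‖ ≤ 1 / 2 := by
      rw [norm_div, div_le_iff₀ hz0]; linarith
    refine (norm_log_one_add_sub_self_le (by linarith)).trans ?_
    have h2 : (1 - ‖u / z‖)⁻¹ ≤ 2 := by
      rw [inv_le_comm₀ (by linarith) (by norm_num)]; linarith
    rw [← div_pow, ← norm_div]
    nlinarith [sq_nonneg ‖u / z‖]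
  have e : log (1 + q / z) - log (1 + p / z) - (q - p) * log (1 + 1 / z) =
      (log (1 + q / z) - q / z) - (log (1 + p / z) - p / z) -
        (q - p) * (log (1 + 1 / z) - 1 / z) := by ring
  have k1 := key 1 (by simpa using hM)
  rw [norm_one, one_pow] at k1
  have hqp : ‖q - p‖ ≤ 2 * M := (norm_sub_le _ _).trans (by linarith)
  have hM2 : ∀ u : ℂ, ‖u‖ ≤ M → ‖log (1 + u / z) - u / z‖ ≤ M ^ 2 / ‖z‖ ^ 2 := fun u hu =>
    (key u hu).trans (by gcongr)
  calc _ ≤ ‖log (1 + q / z) - q / z‖ + ‖log (1 + p / z) - p / z‖ +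
        ‖q - p‖ * ‖log (1 + 1 / z) - 1 / z‖ := by
          rw [e, ← norm_mul]
          exact (norm_sub_le _ _).trans (add_le_add_left (norm_sub_le _ _) _)
    _ ≤ M ^ 2 / ‖z‖ ^ 2 + M ^ 2 / ‖z‖ ^ 2 + 2 * M * (1 / ‖z‖ ^ 2) := by
          gcongr
          · exact hM2 q hq
          · exact hM2 p hp
    _ = (2 * M ^ 2 + 2 * M) / ‖z‖ ^ 2 := by ring
    _ ≤ 4 * M ^ 2 / ‖z‖ ^ 2 := by gcongr; nlinarith

/-- Uniform bound for the finite Euler products. -/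
lemma Complex.prod_quotient_le {p q w : ℂ} {M : ℝ} (hp : ‖p‖ ≤ M) (hq : ‖q‖ ≤ M)
    (hM : 1 ≤ M) (hw : 0 ≤ w.re) (hwM : 2 * M ≤ ‖w‖) (n : ℕ) :
    ∏ j ∈ Finset.range n, (‖w + q + j‖ / ‖w + p + j‖) ≤
      (‖w + n‖ / ‖w‖) ^ (q - p).re * Real.exp (|(q - p).im| * π +
        4 * M ^ 2 * ∑' j : ℕ, 1 / (1 + (j : ℝ) ^ 2)) := by
  have hw0 : 0 < ‖w‖ := by linarith
  have hsq : ∀ j : ℕ, ‖w‖ ^ 2 + (j : ℝ) ^ 2 ≤ ‖w + j‖ ^ 2 := fun j => by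
    simpa using re_add_nonneg_norm_le hw (Nat.cast_nonneg j)
  have hz : ∀ j : ℕ, 2 * M ≤ ‖w + j‖ := fun j =>
    hwM.trans (le_of_sq_le_sq (by nlinarith [hsq j, sq_nonneg (j : ℝ)]) (norm_nonneg _))
  have hzre : ∀ j : ℕ, 0 ≤ (w + j).re := fun j => by
    simp only [add_re, natCast_re]; positivity
  have hz0 : ∀ j : ℕ, w + j ≠ 0 := fun j => norm_pos_iff.1 (by linarith [hz j])
  set E : ℕ → ℂ := fun j => log (1 + q / (w + j)) - log (1 + p / (w + j)) -
    (q - p) * log (1 + 1 / (w + j)) with hE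
  have hterm : ∀ j : ℕ, ‖w + q + j‖ / ‖w + p + j‖ =
      Real.exp (((q - p) * (log (w + (j + 1 : ℕ)) - log (w + j)) + E j).re) := by
    intro j
    have hne : ∀ u : ℂ, ‖u‖ ≤ M → 1 + u / (w + j) ≠ 0 := by
      intro u hu h
      have : ‖u / (w + j)‖ < 1 := by
        rw [norm_div, div_lt_one (by linarith [hz j])]; linarith [hz j]
      rw [show u / (w + j) = -1 by linear_combination h] at this
      simp at this
    have e1 : (w + (j + 1 : ℕ) : ℂ) = w + j + 1 := by push_cast; ring
    rw [e1, ← log_one_add_inv (hzre j) (hz0 j), hE]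
    dsimp only
    rw [add_sub_cancel, ← norm_exp, exp_sub, exp_log (hne q hq), exp_log (hne p hp), norm_div]
    have e2 : ∀ u : ℂ, w + u + j = (w + j) * (1 + u / (w + j)) := by
      intro u; field_simp [hz0 j]; ring
    rw [e2 q, e2 p, norm_mul, norm_mul, mul_div_mul_left _ _ (norm_ne_zero_iff.2 (hz0 j))]
  have hEb : ∀ j : ℕ, (E j).re ≤ 4 * M ^ 2 * (1 / (1 + (j : ℝ) ^ 2)) := by
    intro j
    refine (re_le_norm _).trans ((norm_log_quotient_sub_le hp hq hM (hz j)).trans ?_)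
    rw [mul_one_div]
    gcongr
    nlinarith [hsq j]
  have hsum : Summable fun j : ℕ => 1 / (1 + (j : ℝ) ^ 2) := by
    refine Summable.of_nonneg_of_le (fun j => by positivity) (fun j => ?_)
      ((summable_nat_add_iff 1).2 (Real.summable_one_div_nat_pow.2 one_lt_two) |>.mul_left 2)
    rw [mul_one_div, div_le_div_iff₀ (by positivity) (by positivity)]
    push_cast
    nlinarith [sq_nonneg ((j : ℝ) - 1)]
  simp_rw [hterm]
  rw [← Real.exp_sum, ← re_sum, Finset.sum_add_distrib, ← Finset.mul_sum, Finset.sum_range_sub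
    (fun j : ℕ => log (w + j)), Nat.cast_zero, add_zero, Real.rpow_def_of_pos
    (div_pos (by linarith [hz n]) hw0), ← Real.exp_add, Real.exp_le_exp, add_re, mul_re,
    Real.log_div (by linarith [hz n]) hw0.ne', re_sum, sub_re (log _), sub_im (log _), log_re,
    log_re, log_im, log_im]
  have hb : ∑ j ∈ Finset.range n, (E j).re ≤ 4 * M ^ 2 * ∑' j : ℕ, 1 / (1 + (j : ℝ) ^ 2) := by
    refine (Finset.sum_le_sum fun j _ => hEb j).trans ?_
    rw [← Finset.mul_sum]
    gcongr
    exact hsum.sum_le_tsum _ fun j _ => by positivity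
  have h1 := abs_le.1 (abs_arg_le_pi_div_two_iff.2 hw)
  have h2 := abs_le.1 (abs_arg_le_pi_div_two_iff.2 (hzre n))
  have h3 : -((q - p).im * (arg (w + n) - arg w)) ≤ |(q - p).im| * π := by
    refine (neg_le_abs _).trans ?_
    rw [abs_mul]
    gcongr
    exact abs_le.2 ⟨by linarith, by linarith⟩
  linarith

lemma Complex.norm_GammaSeq (s : ℂ) {n : ℕ} (hn : n ≠ 0) :
    ‖GammaSeq s n‖ =
      (n : ℝ) ^ s.re * n.factorial / ∏ j ∈ Finset.range (n + 1), ‖s + j‖ := by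
  rw [GammaSeq, norm_div, norm_mul, norm_prod, norm_natCast_cpow_of_pos (Nat.pos_of_ne_zero hn),
    norm_natCast]

/-- `Γ(w + p) = O(|w|^{Re(p - q)} Γ(w + q))` uniformly on the right half-plane. -/
theorem Complex.exists_norm_Gamma_add_le (p q : ℂ) : ∃ C R : ℝ, ∀ w : ℂ, 0 ≤ w.re → R ≤ ‖w‖ →
    ‖Gamma (w + p)‖ ≤ C * (‖w‖ ^ (p - q).re * ‖Gamma (w + q)‖) := by
  set M : ℝ := max 1 (max ‖p‖ ‖q‖)
  have hM : 1 ≤ M := le_max_left _ _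
  have hp : ‖p‖ ≤ M := (le_max_left _ _).trans (le_max_right _ _)
  have hq : ‖q‖ ≤ M := (le_max_right _ _).trans (le_max_right _ _)
  set K := Real.exp (|(q - p).im| * π + 4 * M ^ 2 * ∑' j : ℕ, 1 / (1 + (j : ℝ) ^ 2))
  refine ⟨K, 2 * M, fun w hw hwM => ?_⟩
  have hw0 : 0 < ‖w‖ := by linarith
  have hpos : ∀ u : ℂ, ‖u‖ ≤ M → ∀ j : ℕ, 0 < ‖w + u + j‖ := by
    intro u hu j
    have h1 : ‖w‖ ≤ ‖w + j‖ := by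
      have := re_add_nonneg_norm_le hw (Nat.cast_nonneg (α := ℝ) j)
      rw [ofReal_natCast] at this
      exact le_of_sq_le_sq (by nlinarith [sq_nonneg (j : ℝ)]) (norm_nonneg _)
    have h2 : ‖w + j‖ ≤ ‖w + u + j‖ + ‖u‖ := by
      calc ‖w + j‖ = ‖(w + u + j) - u‖ := by congr 1; ring
        _ ≤ _ := norm_sub_le _ _
    linarith
  have hbound : ∀ n : ℕ, n ≠ 0 → ‖GammaSeq (w + p) n‖ ≤
      (‖w + (n + 1 : ℕ)‖ / n) ^ (q - p).re *
        (K * (‖w‖ ^ (p - q).re * ‖GammaSeq (w + q) n‖)) := by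
    intro n hn
    have hn0 : (0 : ℝ) < n := by positivity
    have hwn : 0 < ‖w + (n + 1 : ℕ)‖ := by
      have := hpos 0 (by rw [norm_zero]; linarith) (n + 1)
      rwa [add_zero] at this
    have h := prod_quotient_le hp hq hM hw hwM (n + 1)
    rw [Finset.prod_div_distrib] at h
    have hP : 0 < ∏ j ∈ Finset.range (n + 1), ‖w + p + j‖ :=
      Finset.prod_pos fun j _ => hpos p hp j
    have hQ : 0 < ∏ j ∈ Finset.range (n + 1), ‖w + q + j‖ :=
      Finset.prod_pos fun j _ => hpos q hq j
    rw [norm_GammaSeq _ hn, norm_GammaSeq _ hn]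
    set P := ∏ j ∈ Finset.range (n + 1), ‖w + p + j‖
    set Q := ∏ j ∈ Finset.range (n + 1), ‖w + q + j‖
    change _ ≤ _ * K at h
    have e1 : (n : ℝ) ^ (w + p).re * n.factorial / P =
        (n : ℝ) ^ (p - q).re * ((n : ℝ) ^ (w + q).re * n.factorial / Q) * (Q / P) := by
      have : (w + p).re = (p - q).re + (w + q).re := by
        simp only [add_re, sub_re]; ring
      rw [this, Real.rpow_add hn0]
      field_simp
    have e2 : (p - q).re = -(q - p).re := by simp
    rw [e1]
    refine (mul_le_mul_of_nonneg_left h (by positivity)).trans_eq ?_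
    rw [e2, Real.div_rpow hwn.le hw0.le, Real.div_rpow hwn.le hn0.le, Real.rpow_neg hn0.le,
      Real.rpow_neg hw0.le]
    field_simp
  have hlim1 : Tendsto (fun n : ℕ => (‖w + (n + 1 : ℕ)‖ / n) ^ (q - p).re) atTop (𝓝 1) := by
    have h0 : Tendsto (fun n : ℕ => (w + 1) * ((n : ℂ))⁻¹ + 1) atTop (𝓝 ((w + 1) * 0 + 1)) :=
      (tendsto_inv_atTop_nhds_zero_nat (𝕜 := ℂ)).const_mul (w + 1) |>.add_const 1
    have h1 : Tendsto (fun n : ℕ => ‖w + (n + 1 : ℕ)‖ / n) atTop (𝓝 1) := by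
      have h2 := h0.norm
      rw [mul_zero, zero_add, norm_one] at h2
      refine h2.congr' ?_
      filter_upwards [eventually_ne_atTop 0] with n hn
      have hn' : (n : ℂ) ≠ 0 := by exact_mod_cast hn
      rw [show (w + 1) * ((n : ℂ))⁻¹ + 1 = (w + (n + 1 : ℕ)) / n by
        field_simp; push_cast; ring, norm_div, norm_natCast]
    simpa using h1.rpow_const (p := (q - p).re) (Or.inl one_ne_zero)
  have hlim2 := (GammaSeq_tendsto_Gamma (w + q)).norm.const_mul (‖w‖ ^ (p - q).re)
    |>.const_mul K
  have hlim := hlim1.mul hlim2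
  rw [one_mul] at hlim
  refine le_of_tendsto_of_tendsto (GammaSeq_tendsto_Gamma (w + p)).norm hlim ?_
  filter_upwards [eventually_ne_atTop 0] with n hn using hbound n hn

/-- The filter of neighbourhoods of infinity in the closed right half-plane. -/
noncomputable def rightHalfPlaneAtInfty : Filter ℂ := comap norm atTop ⊓ 𝓟 {w | 0 ≤ w.re}

lemma eventually_rightHalfPlaneAtInfty {P : ℂ → Prop} :
    (∀ᶠ w in rightHalfPlaneAtInfty, P w) ↔ ∃ R : ℝ, ∀ w : ℂ, 0 ≤ w.re → R ≤ ‖w‖ → P w := by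
  rw [rightHalfPlaneAtInfty, eventually_inf_principal, eventually_comap, eventually_atTop]
  constructor
  · rintro ⟨R, hR⟩
    exact ⟨R, fun w hw hwR => hR ‖w‖ hwR w rfl hw⟩
  · rintro ⟨R, hR⟩
    exact ⟨R, fun b hb w hwb hw => hR w hw (hwb ▸ hb)⟩

/-- **Gamma quotient asymptotics**: `Γ(w + p) ≍ |w|^{Re p} Γ(w)` on the right half-plane. -/
theorem Complex.Gamma_add_isTheta (p : ℂ) :
    (fun w => Gamma (w + p)) =Θ[rightHalfPlaneAtInfty] fun w => ‖w‖ ^ p.re * ‖Gamma w‖ := by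
  constructor
  · obtain ⟨C, R, h⟩ := exists_norm_Gamma_add_le p 0
    refine IsBigO.of_bound C (eventually_rightHalfPlaneAtInfty.2 ⟨R, fun w hw hR => ?_⟩)
    rw [Real.norm_of_nonneg (by positivity)]
    simpa using h w hw hR
  · obtain ⟨C, R, h⟩ := exists_norm_Gamma_add_le 0 p
    refine IsBigO.of_bound C (eventually_rightHalfPlaneAtInfty.2 ⟨max R 1, fun w hw hR => ?_⟩)
    rw [Real.norm_of_nonneg (by positivity)]
    have hw0 : 0 < ‖w‖ := by linarith [le_max_right R 1]
    have := h w hw ((le_max_left _ _).trans hR)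
    rw [add_zero, zero_sub, neg_re, Real.rpow_neg hw0.le] at this
    calc ‖w‖ ^ p.re * ‖Gamma w‖ ≤ ‖w‖ ^ p.re * (C * ((‖w‖ ^ p.re)⁻¹ * ‖Gamma (w + p)‖)) := by
          gcongr
      _ = C * ‖Gamma (w + p)‖ := by
          have : ‖w‖ ^ p.re ≠ 0 := (Real.rpow_pos_of_pos hw0 _).ne'
          field_simp

/-! ### Shifting a vertical line of integration across finitely many simple poles -/

lemma integrable_div_sq_add_sq {c : ℝ} (hc : c ≠ 0) :
    Integrable fun y : ℝ => c / (c ^ 2 + y ^ 2) := by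
  have h := (integrable_inv_one_add_sq.comp_div hc).const_mul c⁻¹
  refine h.congr (Eventually.of_forall fun y => ?_)
  have : c ^ 2 + y ^ 2 ≠ 0 := by positivity
  have : 1 + (y / c) ^ 2 ≠ 0 := by positivity
  field_simp

lemma integral_univ_div_sq_add_sq {c : ℝ} (hc : c ≠ 0) :
    ∫ y : ℝ, c / (c ^ 2 + y ^ 2) = π * (c / |c|) := by
  have h := Measure.integral_comp_div (fun y : ℝ => (1 + y ^ 2)⁻¹) c
  rw [integral_univ_inv_one_add_sq, smul_eq_mul] at h
  have e : (fun y : ℝ => c / (c ^ 2 + y ^ 2)) = fun y => c⁻¹ * (1 + (y / c) ^ 2)⁻¹ := by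
    ext y
    have : c ^ 2 + y ^ 2 ≠ 0 := by positivity
    have : 1 + (y / c) ^ 2 ≠ 0 := by positivity
    field_simp
  rw [e, integral_const_mul, h]
  have : |c| ≠ 0 := abs_ne_zero.2 hc
  field_simp
  rw [sq_abs]

lemma ofReal_add_mul_I_ne_zero {c : ℝ} (hc : c ≠ 0) (y : ℝ) : (c : ℂ) + y * I ≠ 0 := fun h =>
  hc (by simpa using congrArg re h)

lemma norm_ofReal_add_mul_I_sq (c y : ℝ) : ‖(c : ℂ) + y * I‖ ^ 2 = c ^ 2 + y ^ 2 := by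
  rw [Complex.sq_norm, normSq_add_mul_I]

lemma integrable_inv_sub_inv_line {c c' : ℝ} (hc : c ≠ 0) (hc' : c' ≠ 0) :
    Integrable fun y : ℝ => ((c : ℂ) + y * I)⁻¹ - ((c' : ℂ) + y * I)⁻¹ := by
  have hcont : Continuous fun y : ℝ => ((c : ℂ) + y * I)⁻¹ - ((c' : ℂ) + y * I)⁻¹ := by
    refine Continuous.sub (Continuous.inv₀ (by fun_prop) (ofReal_add_mul_I_ne_zero hc))
      (Continuous.inv₀ (by fun_prop) (ofReal_add_mul_I_ne_zero hc'))
  refine Integrable.mono' (((integrable_div_sq_add_sq hc).const_mul (|c' - c| / c)).add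
    ((integrable_div_sq_add_sq hc').const_mul (|c' - c| / c'))) hcont.aestronglyMeasurable
    (Eventually.of_forall fun y => ?_)
  have h1 := ofReal_add_mul_I_ne_zero hc y
  have h2 := ofReal_add_mul_I_ne_zero hc' y
  have e : ((c : ℂ) + y * I)⁻¹ - ((c' : ℂ) + y * I)⁻¹ =
      (((c' - c : ℝ) : ℂ)) * (((c : ℂ) + y * I)⁻¹ * ((c' : ℂ) + y * I)⁻¹) := by
    push_cast; field_simp; ring
  have e' : |c' - c| / c * (c / (c ^ 2 + y ^ 2)) + |c' - c| / c' * (c' / (c' ^ 2 + y ^ 2)) =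
      |c' - c| * ((c ^ 2 + y ^ 2)⁻¹ + (c' ^ 2 + y ^ 2)⁻¹) := by
    have : c ^ 2 + y ^ 2 ≠ 0 := by positivity
    have : c' ^ 2 + y ^ 2 ≠ 0 := by positivity
    field_simp
  simp only [Pi.add_apply]
  rw [e, e', norm_mul, norm_real, Real.norm_eq_abs, norm_mul, norm_inv, norm_inv,
    ← norm_ofReal_add_mul_I_sq, ← norm_ofReal_add_mul_I_sq, ← inv_pow, ← inv_pow]
  gcongr
  nlinarith [sq_nonneg (‖(c : ℂ) + y * I‖⁻¹ - ‖(c' : ℂ) + y * I‖⁻¹),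
    sq_nonneg (‖(c : ℂ) + y * I‖⁻¹ + ‖(c' : ℂ) + y * I‖⁻¹)]

lemma integral_inv_sub_inv_line {c c' : ℝ} (hc : c ≠ 0) (hc' : c' ≠ 0) :
    ∫ y : ℝ, (((c : ℂ) + y * I)⁻¹ - ((c' : ℂ) + y * I)⁻¹) =
      ((π * (c / |c|) - π * (c' / |c'|) : ℝ) : ℂ) := by
  have hi := integrable_inv_sub_inv_line hc hc'
  have h1 := integral_neg_eq_self
    (fun y : ℝ => ((c : ℂ) + y * I)⁻¹ - ((c' : ℂ) + y * I)⁻¹) volume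
  have h2 := integral_add hi hi.comp_neg
  rw [h1] at h2
  have e : ∀ y : ℝ, (((c : ℂ) + y * I)⁻¹ - ((c' : ℂ) + y * I)⁻¹) +
      (((c : ℂ) + (-y : ℝ) * I)⁻¹ - ((c' : ℂ) + (-y : ℝ) * I)⁻¹) =
      ((2 * (c / (c ^ 2 + y ^ 2) - c' / (c' ^ 2 + y ^ 2)) : ℝ) : ℂ) := by
    intro y
    have key : ∀ x : ℝ, x ≠ 0 → ((x : ℂ) + y * I)⁻¹ + ((x : ℂ) + (-y : ℝ) * I)⁻¹ =
        2 * (x / (x ^ 2 + y ^ 2)) := by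
      intro x hx
      have a1 := ofReal_add_mul_I_ne_zero hx y
      have a2 := ofReal_add_mul_I_ne_zero hx (-y)
      have a3 : (x : ℂ) ^ 2 + (y : ℂ) ^ 2 = (x + y * I) * (x + (-y : ℝ) * I) := by
        push_cast; linear_combination (y : ℂ) ^ 2 * I_sq
      rw [a3, inv_add_inv a1 a2, mul_div_assoc']
      congr 1
      push_cast
      ring
    push_cast at key ⊢
    linear_combination key c hc - key c' hc'
  rw [integral_congr_ae (Eventually.of_forall e), integral_complex_ofReal, integral_const_mul,
    integral_sub (integrable_div_sq_add_sq hc) (integrable_div_sq_add_sq hc'),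
    integral_univ_div_sq_add_sq hc, integral_univ_div_sq_add_sq hc'] at h2
  push_cast at h2 ⊢
  linear_combination -(1 / 2) * h2

/-- The filter of points of the closed vertical strip `a ≤ Re w ≤ b` with `|Im w| → ∞`. -/
def stripAtInfty (a b : ℝ) : Filter ℂ :=
  comap (fun w => |w.im|) atTop ⊓ 𝓟 {w | a ≤ w.re ∧ w.re ≤ b}

lemma tendsto_horizontal_integral {f : ℂ → ℂ} {a b : ℝ} (hab : a ≤ b)
    (h0 : Tendsto f (stripAtInfty a b) (𝓝 0)) {u : ℝ → ℝ}
    (hu : Tendsto (fun t => |u t|) atTop atTop) :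
    Tendsto (fun t => ∫ x in a..b, f (x + u t * I)) atTop (𝓝 0) := by
  rw [Metric.tendsto_nhds]
  intro ε hε
  set δ := ε / (b - a + 1)
  have hδ : 0 < δ := by apply div_pos hε; linarith
  have h1 := (Metric.tendsto_nhds.1 h0) δ hδ
  rw [stripAtInfty, eventually_inf_principal, eventually_comap] at h1
  filter_upwards [hu.eventually h1] with t ht
  have : ‖∫ x in a..b, f (x + u t * I)‖ ≤ δ * |b - a| := by
    refine intervalIntegral.norm_integral_le_of_norm_le_const fun x hx => ?_
    rw [uIoc_of_le hab] at hx
    have := ht (x + u t * I) (by simp) (by simpa using ⟨hx.1.le, hx.2⟩)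
    rw [dist_zero_right] at this
    exact this.le
  rw [dist_zero_right]
  refine this.trans_lt ?_
  rw [abs_of_nonneg (by linarith)]
  calc δ * (b - a) < δ * (b - a + 1) := by gcongr; linarith
    _ = ε := div_mul_cancel₀ _ (by linarith)

lemma integral_line_eq_of_differentiableAt {f : ℂ → ℂ} {a b : ℝ} (hab : a ≤ b)
    (hd : ∀ w : ℂ, a ≤ w.re → w.re ≤ b → DifferentiableAt ℂ f w)
    (h0 : Tendsto f (stripAtInfty a b) (𝓝 0))
    (ha : Integrable fun y : ℝ => f (a + y * I)) (hb : Integrable fun y : ℝ => f (b + y * I)) :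
    ∫ y : ℝ, f (b + y * I) = ∫ y : ℝ, f (a + y * I) := by
  have hrect : ∀ T : ℝ, (∫ x in a..b, f (x + (-T : ℝ) * I)) - (∫ x in a..b, f (x + T * I)) +
      I * (∫ y in (-T)..T, f (b + y * I)) - I * (∫ y in (-T)..T, f (a + y * I)) = 0 := by
    intro T
    have := integral_boundary_rect_eq_zero_of_differentiableOn f (a + (-T : ℝ) * I) (b + T * I) ?_
    · simpa only [add_re, ofReal_re, mul_re, I_re, mul_zero, ofReal_im, I_im, mul_one, sub_self,
        add_zero, add_im, mul_im, zero_add, smul_eq_mul] using this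
    · intro w hw
      rw [mem_reProdIm] at hw
      have h1 := hw.1
      simp only [add_re, ofReal_re, mul_re, I_re, mul_zero, ofReal_im, I_im, mul_one, sub_self,
        add_zero, uIcc_of_le hab] at h1
      exact (hd w h1.1 h1.2).differentiableWithinAt
  have t1 := tendsto_horizontal_integral hab h0 (u := fun t => -t)
    (by simpa using tendsto_abs_atTop_atTop)
  have t2 := tendsto_horizontal_integral hab h0 (u := fun t => t) tendsto_abs_atTop_atTop
  have t3 := (intervalIntegral_tendsto_integral hb tendsto_neg_atTop_atBot tendsto_id).const_mul I
  have t4 := (intervalIntegral_tendsto_integral ha tendsto_neg_atTop_atBot tendsto_id).const_mul I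
  have := tendsto_nhds_unique (((t1.sub t2).add t3).sub t4)
    (tendsto_const_nhds.congr fun T => (hrect T).symm)
  have h : I * ((∫ y : ℝ, f (b + y * I)) - ∫ y : ℝ, f (a + y * I)) = 0 := by
    linear_combination this
  exact sub_eq_zero.1 ((mul_eq_zero.1 h).resolve_left I_ne_zero)

/-- If all singularities are finitely many removable ones, the line integrals agree. -/
lemma integral_line_eq_of_removable {f : ℂ → ℂ} {a b : ℝ} (hab : a ≤ b) {S : Finset ℂ}
    (hS : ∀ p ∈ S, a < p.re ∧ p.re < b)
    (hd : ∀ w : ℂ, a ≤ w.re → w.re ≤ b → w ∉ S → DifferentiableAt ℂ f w)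
    (hr : ∀ p ∈ S, Tendsto (fun w => (w - p) * f w) (𝓝[≠] p) (𝓝 0))
    (h0 : Tendsto f (stripAtInfty a b) (𝓝 0))
    (ha : Integrable fun y : ℝ => f (a + y * I)) (hb : Integrable fun y : ℝ => f (b + y * I)) :
    ∫ y : ℝ, f (b + y * I) = ∫ y : ℝ, f (a + y * I) := by
  classical
  set g : ℂ → ℂ := fun w => if w ∈ S then limUnder (𝓝[≠] w) f else f w with hg
  have hgf : ∀ w, w ∉ S → g w = f w := fun w hw => if_neg hw
  have hmem : ∀ x : ℝ, (x = a ∨ x = b) → ∀ y : ℝ, (x + y * I : ℂ) ∉ S := by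
    rintro x hx y hxy
    have := hS _ hxy
    simp only [add_re, ofReal_re, mul_re, I_re, mul_zero, ofReal_im, I_im, mul_one, sub_self,
      add_zero] at this
    rcases hx with rfl | rfl <;> linarith [this.1, this.2]
  have hnear : ∀ w : ℂ, ∀ᶠ z in 𝓝 w, z ≠ w → z ∉ S := by
    intro w
    have : ((S.erase w : Finset ℂ) : Set ℂ)ᶜ ∈ 𝓝 w :=
      (S.erase w).finite_toSet.isClosed.isOpen_compl.mem_nhds (by simp)
    filter_upwards [this] with z hz hzw hzS
    exact hz (by simpa using ⟨hzS, hzw⟩)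
  have hgd : ∀ w : ℂ, a ≤ w.re → w.re ≤ b → DifferentiableAt ℂ g w := by
    intro w hwa hwb
    by_cases hw : w ∈ S
    · have hstrip : ∀ᶠ z in 𝓝 w, a < z.re ∧ z.re < b :=
        (continuous_re.continuousAt.eventually (lt_mem_nhds (hS w hw).1)).and
          (continuous_re.continuousAt.eventually (gt_mem_nhds (hS w hw).2))
      have hs : {z | z ≠ w → DifferentiableAt ℂ f z} ∈ 𝓝 w := by
        filter_upwards [hstrip, hnear w] with z hz hzS hzw
        exact hd z hz.1.le hz.2.le (hzS hzw)
      have hlim := Complex.differentiableOn_update_limUnder_of_isLittleO hs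
        (fun z hz => (hz.1 hz.2).differentiableWithinAt) (f := f) ?_
      · refine (hlim.differentiableAt hs).congr_of_eventuallyEq ?_
        filter_upwards [hnear w] with z hz
        rcases eq_or_ne z w with rfl | hzw
        · simp [hg, hw]
        · rw [hgf z (hz hzw), Function.update_of_ne hzw]
      · rw [isLittleO_iff_tendsto']
        · have h2 : Tendsto (fun z => (z - w) * f w) (𝓝[≠] w) (𝓝 0) := by
            have : Tendsto (fun z => (z - w) * f w) (𝓝 w) (𝓝 ((w - w) * f w)) :=
              (Continuous.tendsto (by fun_prop) w)
            rw [sub_self, zero_mul] at this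
            exact this.mono_left nhdsWithin_le_nhds
          have := (hr w hw).sub h2
          rw [sub_zero] at this
          refine this.congr fun z => ?_
          rw [div_inv_eq_mul]; ring
        · filter_upwards [self_mem_nhdsWithin] with z hz h
          exact absurd (sub_eq_zero.1 (inv_eq_zero.1 h)) hz
    · refine (hd w hwa hwb hw).congr_of_eventuallyEq ?_
      filter_upwards [hnear w] with z hz
      rcases eq_or_ne z w with rfl | hzw
      · exact hgf z hw
      · exact hgf z (hz hzw)
  have e : ∀ x : ℝ, (x = a ∨ x = b) → (fun y : ℝ => g (x + y * I)) = fun y : ℝ => f (x + y * I) :=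
    fun x hx => funext fun y => hgf _ (hmem x hx y)
  rw [← e a (Or.inl rfl)] at ha ⊢
  rw [← e b (Or.inr rfl)] at hb ⊢
  refine integral_line_eq_of_differentiableAt hab hgd (h0.congr' ?_) ha hb
  rw [stripAtInfty]
  refine Eventually.filter_mono inf_le_left ?_
  rw [eventually_comap]
  obtain ⟨M, hM⟩ := (S.image fun w => |w.im|).bddAbove
  filter_upwards [eventually_gt_atTop M] with t ht w hw
  refine (hgf w fun hwS => ?_).symm
  have := hM (Finset.mem_coe.2 (Finset.mem_image_of_mem (fun w => |w.im|) hwS))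
  linarith

/-- **Shifting a line of integration** across finitely many simple poles: the difference of the two
line integrals is `2π` times the sum of the residues. -/
theorem integral_line_sub_integral_line {f : ℂ → ℂ} {a b : ℝ} (hab : a ≤ b) {S : Finset ℂ}
    {r : ℂ → ℂ} (hS : ∀ p ∈ S, a < p.re ∧ p.re < b)
    (hd : ∀ w : ℂ, a ≤ w.re → w.re ≤ b → w ∉ S → DifferentiableAt ℂ f w)
    (hr : ∀ p ∈ S, Tendsto (fun w => (w - p) * f w) (𝓝[≠] p) (𝓝 (r p)))
    (h0 : Tendsto f (stripAtInfty a b) (𝓝 0))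
    (ha : Integrable fun y : ℝ => f (a + y * I)) (hb : Integrable fun y : ℝ => f (b + y * I)) :
    (∫ y : ℝ, f (b + y * I)) - ∫ y : ℝ, f (a + y * I) = 2 * π * ∑ p ∈ S, r p := by
  classical
  set P : ℝ := b - a + 1
  set k : ℂ → ℂ → ℂ := fun p w => (w - p)⁻¹ - (w - (p + P))⁻¹ with hk
  have kline : ∀ (p : ℂ) (x : ℝ), (fun y : ℝ => k p (x + y * I)) = fun y : ℝ =>
      (fun t : ℝ => (((x - p.re : ℝ) : ℂ) + t * I)⁻¹ - (((x - p.re - P : ℝ) : ℂ) + t * I)⁻¹)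
        (y - p.im) := by
    intro p x
    ext y
    have e1 : (x : ℂ) + y * I - p = ((x - p.re : ℝ) : ℂ) + ((y - p.im : ℝ) : ℂ) * I := by
      apply Complex.ext <;> simp
    have e2 : (x : ℂ) + y * I - (p + P) =
        ((x - p.re - P : ℝ) : ℂ) + ((y - p.im : ℝ) : ℂ) * I := by
      apply Complex.ext <;> simp [sub_sub]
    simp only [hk, e1, e2]
  have kint : ∀ (p : ℂ) (x : ℝ), x - p.re ≠ 0 → x - p.re - P ≠ 0 →
      Integrable (fun y : ℝ => k p (x + y * I)) := by
    intro p x h1 h2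
    rw [kline]
    exact (integrable_inv_sub_inv_line h1 h2).comp_sub_right p.im
  have kval : ∀ (p : ℂ) (x : ℝ), x - p.re ≠ 0 → x - p.re - P ≠ 0 →
      ∫ y : ℝ, k p (x + y * I) = ((π * ((x - p.re) / |x - p.re|) -
        π * ((x - p.re - P) / |x - p.re - P|) : ℝ) : ℂ) := by
    intro p x h1 h2
    rw [kline, integral_sub_right_eq_self (fun t : ℝ => (((x - p.re : ℝ) : ℂ) + t * I)⁻¹ -
      (((x - p.re - P : ℝ) : ℂ) + t * I)⁻¹) p.im, integral_inv_sub_inv_line h1 h2]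
  have ksub : ∀ p ∈ S, (∫ y : ℝ, k p (b + y * I)) = 2 * π ∧ (∫ y : ℝ, k p (a + y * I)) = 0 ∧
      Integrable (fun y : ℝ => k p (b + y * I)) ∧ Integrable (fun y : ℝ => k p (a + y * I)) := by
    intro p hp
    obtain ⟨h1, h2⟩ := hS p hp
    have b1 : 0 < b - p.re := by linarith
    have b2 : b - p.re - P < 0 := by simp only [P]; linarith
    have a1 : a - p.re < 0 := by linarith
    have a2 : a - p.re - P < 0 := by simp only [P]; linarith
    refine ⟨?_, ?_, kint p b b1.ne' b2.ne, kint p a a1.ne a2.ne⟩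
    · rw [kval p b b1.ne' b2.ne, abs_of_pos b1, abs_of_neg b2, div_self b1.ne', div_neg,
        div_self b2.ne]
      push_cast; ring
    · rw [kval p a a1.ne a2.ne, abs_of_neg a1, abs_of_neg a2, div_neg, div_neg,
        div_self a1.ne, div_self a2.ne]
      simp
  have kdiff : ∀ p ∈ S, ∀ w : ℂ, w.re ≤ b → DifferentiableAt ℂ (fun w => (w - (p + P))⁻¹) w := by
    intro p hp w hw
    refine ((differentiableAt_id).sub_const _).inv fun h => ?_
    have := congrArg re h
    simp only [sub_re, add_re, ofReal_re, zero_re, P] at this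
    linarith [(hS p hp).1]
  have kdiff' : ∀ p : ℂ, ∀ w : ℂ, w ≠ p → DifferentiableAt ℂ (fun w => (w - p)⁻¹) w := fun p w h =>
    ((differentiableAt_id).sub_const _).inv (sub_ne_zero.2 h)
  have ktend : ∀ p : ℂ, Tendsto (fun w => (w - p)⁻¹) (stripAtInfty a b) (𝓝 0) := by
    intro p
    refine tendsto_inv₀_cobounded.comp (tendsto_norm_atTop_iff_cobounded.1 ?_)
    have h1 : Tendsto (fun w : ℂ => |w.im| - |p.im|) (stripAtInfty a b) atTop :=
      tendsto_atTop_add_const_right _ _ (tendsto_comap.mono_left inf_le_left)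
    refine tendsto_atTop_mono (fun w => ?_) h1
    exact (abs_sub_abs_le_abs_sub _ _).trans (by simpa using abs_im_le_norm (w - p))
  have main := integral_line_eq_of_removable (f := fun w => f w - ∑ p ∈ S, r p * k p w) hab hS
    ?_ ?_ ?_ ?_ ?_
  · have expand : ∀ x : ℝ, Integrable (fun y : ℝ => f (x + y * I)) →
        (∀ p ∈ S, Integrable (fun y : ℝ => k p (x + y * I))) →
        ∫ y : ℝ, (f (x + y * I) - ∑ p ∈ S, r p * k p (x + y * I)) =
          (∫ y : ℝ, f (x + y * I)) - ∑ p ∈ S, r p * ∫ y : ℝ, k p (x + y * I) := by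
      intro x h1 h2
      rw [integral_sub h1 (integrable_finsetSum _ fun p hp => (h2 p hp).const_mul _),
        integral_finsetSum _ fun p hp => (h2 p hp).const_mul _]
      simp_rw [integral_const_mul]
    rw [expand b hb fun p hp => (ksub p hp).2.2.1, expand a ha fun p hp => (ksub p hp).2.2.2,
      Finset.sum_congr rfl fun p hp => congrArg (r p * ·) (ksub p hp).1,
      Finset.sum_congr rfl fun p hp => congrArg (r p * ·) (ksub p hp).2.1] at main
    simp only [mul_zero, Finset.sum_const_zero, sub_zero, ← Finset.sum_mul] at main
    linear_combination main
  · intro w hwa hwb hw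
    refine (hd w hwa hwb hw).sub (DifferentiableAt.fun_sum fun p hp => ?_)
    exact ((kdiff' p w (fun h => hw (h ▸ hp))).sub (kdiff p hp w hwb)).const_mul _
  · intro p hp
    have c1 : Tendsto (fun w : ℂ => w - p) (𝓝[≠] p) (𝓝 0) := by
      have : Tendsto (fun w : ℂ => w - p) (𝓝 p) (𝓝 (p - p)) := Continuous.tendsto (by fun_prop) p
      rw [sub_self] at this
      exact this.mono_left nhdsWithin_le_nhds
    have cont : ∀ {h : ℂ → ℂ}, DifferentiableAt ℂ h p →
        Tendsto (fun w => (w - p) * h w) (𝓝[≠] p) (𝓝 0) := by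
      intro h hh
      simpa using c1.mul (hh.continuousAt.tendsto.mono_left nhdsWithin_le_nhds)
    have hreg : DifferentiableAt ℂ (fun w => ∑ q ∈ S.erase p, r q * k q w) p := by
      refine DifferentiableAt.fun_sum fun q hq => ?_
      rw [Finset.mem_erase] at hq
      exact ((kdiff' q p hq.1.symm).sub (kdiff q hq.2 p (hS p hp).2.le)).const_mul _
    have h3 := ((hr p hp).sub (tendsto_const_nhds (x := r p))).add
      ((cont ((kdiff p hp p (hS p hp).2.le).const_mul (r p))).sub (cont hreg))
    simp only [sub_self, add_zero] at h3
    refine h3.congr' ?_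
    filter_upwards [self_mem_nhdsWithin] with w hw
    have : w - p ≠ 0 := sub_ne_zero.2 hw
    rw [← Finset.add_sum_erase S _ hp]
    have e : (w - p) * k p w = 1 - (w - p) * (w - (p + P))⁻¹ := by
      simp only [hk]; rw [mul_sub, mul_inv_cancel₀ this]
    linear_combination r p * e
  · have h4 := h0.sub (tendsto_finsetSum S fun p _ =>
      ((ktend p).sub (ktend (p + P))).const_mul (r p))
    simpa using h4
  · exact ha.sub (integrable_finsetSum _ fun p hp => (ksub p hp).2.2.2.const_mul _)
  · exact hb.sub (integrable_finsetSum _ fun p hp => (ksub p hp).2.2.1.const_mul _)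

/-! ### Reflected Gamma factors -/

lemma Complex.sq_norm_sin (z : ℂ) :
    ‖sin z‖ ^ 2 = Real.sin z.re ^ 2 + Real.sinh z.im ^ 2 := by
  have h : sin z = ((Real.sin z.re * Real.cosh z.im : ℝ) : ℂ) +
      ((Real.cos z.re * Real.sinh z.im : ℝ) : ℂ) * I := by
    push_cast; exact sin_eq z
  rw [h, Complex.sq_norm, normSq_add_mul_I]
  linear_combination Real.sin z.re ^ 2 * Real.cosh_sq z.im +
    Real.sinh z.im ^ 2 * Real.sin_sq_add_cos_sq z.re

lemma Complex.norm_sin_le_cosh (z : ℂ) : ‖sin z‖ ≤ Real.cosh z.im := by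
  refine le_of_sq_le_sq ?_ (Real.cosh_pos _).le
  rw [sq_norm_sin, Real.cosh_sq]
  linarith [Real.sin_sq_le_one z.re]

lemma Complex.abs_sin_re_mul_cosh_le (z : ℂ) : |Real.sin z.re| * Real.cosh z.im ≤ ‖sin z‖ := by
  refine le_of_sq_le_sq ?_ (norm_nonneg _)
  rw [sq_norm_sin, mul_pow, sq_abs, Real.cosh_sq]
  nlinarith [Real.sin_sq_le_one z.re, sq_nonneg (Real.sinh z.im)]

lemma Complex.half_cosh_le_norm_sin {z : ℂ} (hz : 1 ≤ |z.im|) :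
    1 / 2 * Real.cosh z.im ≤ ‖sin z‖ := by
  refine le_of_sq_le_sq ?_ (norm_nonneg _)
  rw [sq_norm_sin, mul_pow, Real.cosh_sq]
  have h1 : 1 ≤ Real.sinh z.im ^ 2 := by
    rw [← sq_abs, Real.abs_sinh]
    have : |z.im| ≤ Real.sinh |z.im| := Real.self_le_sinh_iff.2 (abs_nonneg _)
    nlinarith
  nlinarith [sq_nonneg (Real.sin z.re)]

lemma Real.cosh_add_le (u v : ℝ) : Real.cosh (u + v) ≤ 2 * Real.exp |v| * Real.cosh u := by
  rw [← Real.cosh_abs (u + v), ← Real.cosh_abs u, Real.cosh_eq, Real.cosh_eq]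
  have h1 : Real.exp |u + v| ≤ Real.exp |v| * Real.exp |u| := by
    rw [← Real.exp_add, Real.exp_le_exp]; linarith [abs_add_le u v]
  have h2 : Real.exp (-|u + v|) ≤ Real.exp |u + v| := by
    rw [Real.exp_le_exp]; linarith [abs_nonneg (u + v)]
  have h3 := mul_pos (Real.exp_pos |v|) (Real.exp_pos (-|u|))
  linarith

lemma Complex.inv_Gamma_eq {z : ℂ} (h : Gamma (1 - z) ≠ 0) :
    (Gamma z)⁻¹ = Gamma (1 - z) * (sin (π * z) / π) := by
  have h1 := Gamma_mul_Gamma_one_sub z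
  have hpi : (π : ℂ) ≠ 0 := ofReal_ne_zero.2 Real.pi_ne_zero
  rcases eq_or_ne (sin (π * z)) 0 with hs | hs
  · rw [hs, div_zero] at h1
    rw [(mul_eq_zero.1 h1).resolve_right h, hs]; simp
  · have hz : Gamma z ≠ 0 := fun h0 => by
      rw [h0, zero_mul] at h1
      exact div_ne_zero hpi hs h1.symm
    rw [eq_div_iff hs] at h1
    refine inv_eq_of_mul_eq_one_right ?_
    rw [← mul_assoc, ← mul_div_assoc, h1, div_self hpi]

lemma eventually_Gamma_add_ne_zero (p : ℂ) :
    ∀ᶠ w in rightHalfPlaneAtInfty, Gamma (w + p) ≠ 0 := by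
  refine eventually_rightHalfPlaneAtInfty.2 ⟨‖p‖ + 1, fun w hw hR => Gamma_ne_zero fun m h => ?_⟩
  have h1 : ‖w‖ ≤ ‖w + m‖ := by
    have := re_add_nonneg_norm_le hw (Nat.cast_nonneg (α := ℝ) m)
    rw [ofReal_natCast] at this
    exact le_of_sq_le_sq (by nlinarith [sq_nonneg (m : ℝ)]) (norm_nonneg _)
  rw [show w + m = -p by linear_combination h, norm_neg] at h1
  linarith

lemma eventually_norm_pos : ∀ᶠ w in rightHalfPlaneAtInfty, 0 < ‖w‖ :=
  eventually_rightHalfPlaneAtInfty.2 ⟨1, fun _ _ h => by linarith⟩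

lemma Gamma_quotient_isTheta (p₁ p₂ q₁ q₂ : ℂ) :
    (fun w => Gamma (w + p₁) * Gamma (w + p₂) * (Gamma (w + q₁) * Gamma (w + q₂))⁻¹)
      =Θ[rightHalfPlaneAtInfty] fun w => ‖w‖ ^ (p₁ + p₂ - (q₁ + q₂)).re := by
  refine (((Gamma_add_isTheta p₁).mul (Gamma_add_isTheta p₂)).mul
    ((Gamma_add_isTheta q₁).mul (Gamma_add_isTheta q₂)).inv).trans_eventuallyEq ?_
  filter_upwards [eventually_norm_pos, eventually_Gamma_add_ne_zero 0] with w hw hG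
  rw [add_zero, ← norm_ne_zero_iff] at hG
  simp only [sub_re, add_re, Real.rpow_sub hw, Real.rpow_add hw]
  have : ∀ x : ℝ, ‖w‖ ^ x ≠ 0 := fun x => (Real.rpow_pos_of_pos hw x).ne'
  have h1 := this q₁.re
  have h2 := this q₂.re
  field_simp

/-- The elementary factor of the Mellin–Barnes integrand. -/
noncomputable def mellinBarnesFactor (D a b w : ℂ) : ℂ :=
  Gamma (b + w) * Gamma (a - w) * (Gamma (D - b - w))⁻¹ * (Gamma (D - a + w))⁻¹

/-- `w` stays away from the poles of `Γ(a - w)`, in a quantitative sense. -/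
def AwayFromPoles (ε : ℝ) (a w : ℂ) : Prop :=
  ε * Real.cosh (π * (a - w) : ℂ).im ≤ ‖sin (π * (a - w))‖

lemma exists_norm_sin_sub_le_cosh (c a : ℂ) : ∃ C, 0 ≤ C ∧ ∀ w : ℂ,
    ‖sin (π * (c - w))‖ ≤ C * Real.cosh (π * (a - w) : ℂ).im := by
  refine ⟨2 * Real.exp |(π * (c - a) : ℂ).im|, by positivity, fun w => ?_⟩
  refine (norm_sin_le_cosh _).trans ?_
  have : (π * (c - w) : ℂ).im = (π * (a - w) : ℂ).im + (π * (c - a) : ℂ).im := by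
    rw [← add_im]; congr 1; ring
  rw [this]
  exact Real.cosh_add_le _ _

lemma re_exponent (D a b : ℂ) :
    (b + (1 - D + b) - (1 - a + (D - a))).re = (2 * (a + b - D)).re := by
  congr 1; ring

theorem mellinBarnesFactor_isBigO (D a b : ℂ) {l : Filter ℂ} (hl : l ≤ rightHalfPlaneAtInfty)
    {ε : ℝ} (hε : 0 < ε) (hg : ∀ᶠ w in l, AwayFromPoles ε a w) :
    mellinBarnesFactor D a b =O[l] fun w => ‖w‖ ^ (2 * (a + b - D)).re := by
  obtain ⟨C, hC, hsin⟩ := exists_norm_sin_sub_le_cosh (D - b) a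
  have hR := ((Gamma_quotient_isTheta b (1 - D + b) (1 - a) (D - a)).1).mono hl
  rw [re_exponent] at hR
  have hΦ : (fun w => sin (π * (D - b - w)) * (sin (π * (a - w)))⁻¹) =O[l]
      fun _ => (1 : ℝ) := by
    refine IsBigO.of_bound (C / ε) ?_
    filter_upwards [hg] with w hw
    have hc := Real.cosh_pos (π * (a - w) : ℂ).im
    rw [norm_mul, norm_inv, norm_one, mul_one, ← div_eq_mul_inv]
    calc _ ≤ (C * Real.cosh (π * (a - w) : ℂ).im) / (ε * Real.cosh (π * (a - w) : ℂ).im) :=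
          div_le_div₀ (by positivity) (hsin w) (by positivity) hw
      _ = C / ε := by field_simp
  have := hR.mul hΦ
  simp only [mul_one] at this
  refine this.congr' ?_ EventuallyEq.rfl
  filter_upwards [hl (eventually_Gamma_add_ne_zero (1 - a)),
    hl (eventually_Gamma_add_ne_zero (1 - D + b))] with w h1 h2
  have e1 : 1 - (a - w) = w + (1 - a) := by ring
  have e2 : 1 - (D - b - w) = w + (1 - D + b) := by ring
  have i1 := inv_Gamma_eq (z := a - w) (by rwa [e1])
  have i2 := inv_Gamma_eq (z := D - b - w) (by rwa [e2])
  rw [e1] at i1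
  rw [e2] at i2
  have hpi : (π : ℂ) ≠ 0 := ofReal_ne_zero.2 Real.pi_ne_zero
  rw [mellinBarnesFactor, i2, ← inv_inv (Gamma (a - w)), i1, add_comm b w,
    show D - a + w = w + (D - a) by ring]
  simp only [mul_inv, inv_div]
  field_simp

/-- The elementary factor with `Γ(a - w)` replaced by the size of its residue at `w = a + k`. -/
noncomputable def mellinBarnesResidueFactor (D a b : ℂ) (k : ℕ) : ℂ :=
  Gamma (b + (a + k)) * ((-1) ^ k / (k.factorial : ℂ)) * (Gamma (D - b - (a + k)))⁻¹ *
    (Gamma (D - a + (a + k)))⁻¹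

lemma tendsto_add_natCast_rightHalfPlane {a : ℂ} (ha : 0 < a.re) :
    Tendsto (fun k : ℕ => a + k) atTop rightHalfPlaneAtInfty := by
  rw [rightHalfPlaneAtInfty, tendsto_inf, tendsto_comap_iff, tendsto_principal]
  refine ⟨tendsto_atTop_mono (fun k => ?_) tendsto_natCast_atTop_atTop,
    Eventually.of_forall fun k => ?_⟩
  · refine le_trans ?_ (re_le_norm _)
    simp only [add_re, natCast_re]; linarith
  · simp only [Set.mem_ofPred_eq, add_re, natCast_re]; positivity

theorem mellinBarnesResidueFactor_isBigO (D a b : ℂ) (ha : 0 < a.re) :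
    (fun k => mellinBarnesResidueFactor D a b k) =O[atTop]
      fun k : ℕ => ‖a + k‖ ^ (2 * (a + b - D)).re := by
  have ht := tendsto_add_natCast_rightHalfPlane ha
  obtain ⟨C, hC, hsin⟩ := exists_norm_sin_sub_le_cosh (D - b) a
  have hR := ((Gamma_quotient_isTheta b (1 - D + b) (1 - a) (D - a)).1).comp_tendsto ht
  rw [re_exponent] at hR
  have hΦ : (fun k : ℕ => sin (π * (D - b - (a + k))) / π * (-1) ^ k) =O[atTop]
      fun _ => (1 : ℝ) := by
    refine IsBigO.of_bound (C / π) (Eventually.of_forall fun k => ?_)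
    rw [norm_mul, norm_pow, norm_neg, norm_one, one_pow, norm_div, norm_real,
      Real.norm_of_nonneg Real.pi_pos.le, norm_one, mul_one, mul_one]
    have := hsin (a + k)
    rw [show (π * (a - (a + k)) : ℂ).im = 0 by simp, Real.cosh_zero, mul_one] at this
    gcongr
  have := hR.mul hΦ
  simp only [mul_one] at this
  refine this.congr' ?_ EventuallyEq.rfl
  filter_upwards [ht (eventually_Gamma_add_ne_zero (1 - D + b))] with k h2
  have e2 : 1 - (D - b - (a + k)) = a + k + (1 - D + b) := by ring
  have i2 := inv_Gamma_eq (z := D - b - (a + k)) (by rw [e2]; exact h2)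
  rw [e2] at i2
  simp only [Function.comp]
  rw [mellinBarnesResidueFactor, i2, ← Gamma_nat_eq_factorial,
    show a + k + (1 - a) = (k : ℂ) + 1 by ring, add_comm b,
    show D - a + (a + k) = a + k + (D - a) by ring]
  simp only [mul_inv]
  ring

lemma tendsto_mul_Gamma_neg_nat_add (k : ℕ) :
    Tendsto (fun u : ℂ => u * Gamma (-k + u)) (𝓝[≠] 0) (𝓝 ((-1) ^ k / (k.factorial : ℂ))) := by
  induction k with
  | zero => simpa using tendsto_self_mul_Gamma_nhds_zero
  | succ k ih =>
    have h1 : Tendsto (fun u : ℂ => -((k + 1 : ℕ) : ℂ) + u) (𝓝[≠] 0) (𝓝 (-((k + 1 : ℕ) : ℂ))) := by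
      have : Tendsto (fun u : ℂ => -((k + 1 : ℕ) : ℂ) + u) (𝓝 0) (𝓝 (-((k + 1 : ℕ) : ℂ) + 0)) :=
        Continuous.tendsto (by fun_prop) 0
      rw [add_zero] at this
      exact this.mono_left nhdsWithin_le_nhds
    have hk : -((k + 1 : ℕ) : ℂ) ≠ 0 := neg_ne_zero.2 (Nat.cast_ne_zero.2 k.succ_ne_zero)
    have h2 := ih.div h1 hk
    have e : (-1 : ℂ) ^ k / (k.factorial : ℂ) / -((k + 1 : ℕ) : ℂ) =
        (-1) ^ (k + 1) / ((k + 1).factorial : ℂ) := by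
      rw [Nat.factorial_succ, Nat.cast_mul, pow_succ, div_div, mul_neg_one, mul_neg, div_neg,
        neg_div, mul_comm ((k.factorial : ℕ) : ℂ)]
    rw [e] at h2
    refine h2.congr' ?_
    filter_upwards [h1.eventually_ne hk] with u hu
    simp only [Pi.div_apply]
    rw [show -(k : ℂ) + u = (-((k + 1 : ℕ) : ℂ) + u) + 1 by push_cast; ring,
      Gamma_add_one _ hu]
    field_simp

/-! ### The Mellin–Barnes integrand -/

section Integrand

lemma prod_rpow_isBigO {α ι : Type*} {l : Filter α} {s : Finset ι} {f : ι → α → ℂ} {g : α → ℝ}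
    {e : ι → ℝ} (hg : ∀ᶠ x in l, 0 < g x) (h : ∀ j ∈ s, f j =O[l] fun x => g x ^ e j) :
    (fun x => ∏ j ∈ s, f j x) =O[l] fun x => g x ^ ∑ j ∈ s, e j := by
  refine (IsBigO.finsetProd h).congr' EventuallyEq.rfl ?_
  filter_upwards [hg] with x hx
  rw [Real.rpow_sum_of_pos hx]

variable {ι : Type*} [Fintype ι] (D : ℂ) (a b : ι → ℂ)

/-- The Mellin–Barnes integrand in the variable `w`. -/
noncomputable def mellinBarnesIntegrand (w : ℂ) : ℂ := ∏ j, mellinBarnesFactor D (a j) (b j) w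

theorem mellinBarnesIntegrand_isBigO {l : Filter ℂ} (hl : l ≤ rightHalfPlaneAtInfty)
    {ε : ℝ} (hε : 0 < ε) (hg : ∀ j, ∀ᶠ w in l, AwayFromPoles ε (a j) w) :
    mellinBarnesIntegrand D a b =O[l] fun w => ‖w‖ ^ ∑ j, (2 * (a j + b j - D)).re :=
  prod_rpow_isBigO (hl eventually_norm_pos) fun j _ =>
    mellinBarnesFactor_isBigO D (a j) (b j) hl hε (hg j)

lemma stripAtInfty_le_rightHalfPlaneAtInfty {x₁ x₂ : ℝ} (h : 0 ≤ x₁) :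
    stripAtInfty x₁ x₂ ≤ rightHalfPlaneAtInfty := by
  refine inf_le_inf ?_ (principal_mono.2 fun w hw => h.trans hw.1)
  rw [← tendsto_iff_comap]
  exact tendsto_atTop_mono (fun w => abs_im_le_norm w) tendsto_comap

lemma tendsto_norm_rightHalfPlaneAtInfty : Tendsto (fun w : ℂ => ‖w‖) rightHalfPlaneAtInfty atTop :=
  tendsto_comap.mono_left inf_le_left

lemma tendsto_norm_rpow_rightHalfPlaneAtInfty {e : ℝ} (he : e < 0) :
    Tendsto (fun w : ℂ => ‖w‖ ^ e) rightHalfPlaneAtInfty (𝓝 0) := by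
  have := (tendsto_rpow_neg_atTop (neg_pos.2 he)).comp tendsto_norm_rightHalfPlaneAtInfty
  rwa [neg_neg] at this

lemma im_pi_mul_sub (c w : ℂ) : (π * (c - w) : ℂ).im = π * (c.im - w.im) := by simp

lemma re_pi_mul_sub (c w : ℂ) : (π * (c - w) : ℂ).re = π * (c.re - w.re) := by simp

lemma eventually_awayFromPoles_stripAtInfty (c : ℂ) (x₁ x₂ : ℝ) :
    ∀ᶠ w in stripAtInfty x₁ x₂, AwayFromPoles (1 / 2) c w := by
  have : ∀ᶠ w in stripAtInfty x₁ x₂, |c.im| + 1 ≤ |w.im| :=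
    (tendsto_comap.mono_left inf_le_left).eventually (eventually_ge_atTop _)
  filter_upwards [this] with w hw
  refine half_cosh_le_norm_sin ?_
  rw [im_pi_mul_sub, abs_mul, abs_of_pos Real.pi_pos]
  have h1 : 1 ≤ |c.im - w.im| := by
    have := abs_sub_abs_le_abs_sub w.im c.im
    rw [abs_sub_comm] at this; linarith
  nlinarith [Real.pi_gt_three]

variable {D a b}

theorem tendsto_mellinBarnesIntegrand_stripAtInfty
    (he : ∑ j, (2 * (a j + b j - D)).re < 0) {x₁ x₂ : ℝ} (h : 0 ≤ x₁) :
    Tendsto (mellinBarnesIntegrand D a b) (stripAtInfty x₁ x₂) (𝓝 0) :=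
  (mellinBarnesIntegrand_isBigO D a b (stripAtInfty_le_rightHalfPlaneAtInfty h) one_half_pos
    fun j => eventually_awayFromPoles_stripAtInfty (a j) x₁ x₂).trans_tendsto
    ((tendsto_norm_rpow_rightHalfPlaneAtInfty he).mono_left
      (stripAtInfty_le_rightHalfPlaneAtInfty h))

lemma differentiableAt_mellinBarnesFactor {D a b w : ℂ} (hb : 0 < b.re) (hw : 0 ≤ w.re)
    (ha : ∀ k : ℕ, w ≠ a + k) : DifferentiableAt ℂ (mellinBarnesFactor D a b) w := by
  unfold mellinBarnesFactor
  have h1 : DifferentiableAt ℂ (fun w => Gamma (b + w)) w := by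
    refine DifferentiableAt.comp w (differentiableAt_Gamma _ fun m h => ?_) (by fun_prop)
    have := congrArg re h
    simp only [add_re, neg_re, natCast_re] at this
    have := Nat.cast_nonneg (α := ℝ) m
    linarith
  have h2 : DifferentiableAt ℂ (fun w => Gamma (a - w)) w := by
    refine DifferentiableAt.comp w (differentiableAt_Gamma _ fun m h => ?_) (by fun_prop)
    exact ha m (by linear_combination -h)
  have h3 : DifferentiableAt ℂ (fun w => (Gamma (D - b - w))⁻¹) w :=
    (differentiable_one_div_Gamma _).comp w (by fun_prop)
  have h4 : DifferentiableAt ℂ (fun w => (Gamma (D - a + w))⁻¹) w :=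
    (differentiable_one_div_Gamma _).comp w (by fun_prop)
  exact ((h1.mul h2).mul h3).mul h4

lemma differentiableAt_mellinBarnesIntegrand (hb : ∀ j, 0 < (b j).re) {w : ℂ} (hw : 0 ≤ w.re)
    (ha : ∀ j, ∀ k : ℕ, w ≠ a j + k) : DifferentiableAt ℂ (mellinBarnesIntegrand D a b) w := by
  unfold mellinBarnesIntegrand
  exact DifferentiableAt.fun_finsetProd fun j _ =>
    differentiableAt_mellinBarnesFactor (hb j) hw (ha j)

lemma norm_rpow_le_one_add_abs {e : ℝ} (he : e ≤ 0) {w : ℂ} (h : 1 ≤ |w.re| ∨ 1 ≤ |w.im|) :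
    ‖w‖ ^ e ≤ (2⁻¹ : ℝ) ^ e * (1 + ‖w.im‖) ^ e := by
  rw [← Real.mul_rpow (by norm_num) (by positivity), Real.norm_eq_abs]
  refine Real.rpow_le_rpow_of_nonpos (by positivity) ?_ he
  have h1 := abs_re_le_norm w
  have h2 := abs_im_le_norm w
  rcases h with h | h <;> linarith

lemma integrable_one_add_norm_rpow {e : ℝ} (he : e < -1) :
    Integrable fun y : ℝ => (1 + ‖y‖) ^ e := by
  have := integrable_one_add_norm (E := ℝ) (μ := volume) (r := -e) (by simp; linarith)
  rwa [neg_neg] at this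

lemma continuous_mellinBarnesIntegrand_line (hb : ∀ j, 0 < (b j).re) {x : ℝ} (hx : 0 ≤ x)
    (ha : ∀ j, ∀ k : ℕ, x ≠ (a j + k).re) :
    Continuous fun y : ℝ => mellinBarnesIntegrand D a b (x + y * I) := by
  rw [continuous_iff_continuousAt]
  intro y
  refine ContinuousAt.comp (f := fun y : ℝ => (x + y * I : ℂ))
    (differentiableAt_mellinBarnesIntegrand hb (by simpa using hx)
    fun j k h => ha j k ?_).continuousAt (by fun_prop)
  rw [← h]; simp

theorem integrable_mellinBarnesIntegrand_line (he : ∑ j, (2 * (a j + b j - D)).re < -1)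
    (hb : ∀ j, 0 < (b j).re) {x : ℝ} (hx : 0 ≤ x) (ha : ∀ j, ∀ k : ℕ, x ≠ (a j + k).re) :
    Integrable fun y : ℝ => mellinBarnesIntegrand D a b (x + y * I) := by
  have hy : Tendsto (fun y : ℝ => |y|) (cocompact ℝ) atTop := tendsto_norm_cocompact_atTop
  have ht : Tendsto (fun y : ℝ => (x + y * I : ℂ)) (cocompact ℝ) (stripAtInfty x x) := by
    rw [stripAtInfty, tendsto_inf, tendsto_comap_iff, tendsto_principal]
    exact ⟨by simpa [Function.comp_def] using hy, Eventually.of_forall fun y => by simp⟩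
  have h1 := (mellinBarnesIntegrand_isBigO D a b (stripAtInfty_le_rightHalfPlaneAtInfty hx)
    one_half_pos fun j => eventually_awayFromPoles_stripAtInfty (a j) x x).comp_tendsto ht
  have hloc := (continuous_mellinBarnesIntegrand_line (D := D) hb hx ha).locallyIntegrable
    (μ := volume)
  refine hloc.integrable_of_isBigO_cocompact
    (g := fun y => (1 + ‖y‖) ^ ∑ j, (2 * (a j + b j - D)).re) (h1.trans ?_)
    ((integrable_one_add_norm_rpow he).integrableAtFilter _)
  refine IsBigO.of_bound ((2⁻¹ : ℝ) ^ ∑ j, (2 * (a j + b j - D)).re) ?_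
  filter_upwards [hy.eventually (eventually_ge_atTop 1)] with y hy1
  have := norm_rpow_le_one_add_abs (e := ∑ j, (2 * (a j + b j - D)).re) (w := x + y * I)
    (by linarith) (Or.inr (by simpa using hy1))
  rw [Function.comp, Real.norm_of_nonneg (by positivity), Real.norm_of_nonneg (by positivity)]
  simpa using this

/-- Along pole-free lines moving to the right with unit step, the integral tends to zero. -/
theorem tendsto_integral_mellinBarnesIntegrand_line (he : ∑ j, (2 * (a j + b j - D)).re < -1)
    (hb : ∀ j, 0 < (b j).re) {x : ℝ} (hx : 0 ≤ x)
    (ha : ∀ j, Real.sin (π * ((a j).re - x)) ≠ 0) :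
    Tendsto (fun N : ℕ => ∫ y : ℝ, mellinBarnesIntegrand D a b ((x + N : ℝ) + y * I)) atTop
      (𝓝 0) := by
  set e := ∑ j, (2 * (a j + b j - D)).re with he'
  obtain ⟨ε, hε, hle⟩ : ∃ ε > 0, ∀ j, ε ≤ |Real.sin (π * ((a j).re - x))| := by
    rcases isEmpty_or_nonempty ι with h | h
    · exact ⟨1, one_pos, fun j => h.elim j⟩
    · obtain ⟨i, hi⟩ := Finite.exists_min fun j => |Real.sin (π * ((a j).re - x))|
      exact ⟨_, abs_pos.2 (ha i), hi⟩
  set l := rightHalfPlaneAtInfty ⊓ 𝓟 {w : ℂ | ∀ j, AwayFromPoles ε (a j) w} with hl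
  have haway : ∀ (N : ℕ) (y : ℝ), ∀ j, AwayFromPoles ε (a j) ((x + N : ℝ) + y * I) := by
    intro N y j
    refine le_trans ?_ (abs_sin_re_mul_cosh_le _)
    gcongr
    rw [re_pi_mul_sub]
    refine (hle j).trans_eq ?_
    rw [show π * ((a j).re - ((x + N : ℝ) + y * I : ℂ).re) = π * ((a j).re - x) - N * π by
      simp; ring, Real.sin_sub_nat_mul_pi, abs_mul, abs_pow, abs_neg, abs_one, one_pow, one_mul]
  have hO := mellinBarnesIntegrand_isBigO D a b (l := l) inf_le_left hε fun j =>
    Eventually.filter_mono inf_le_right <| eventually_principal.2 fun w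
      (hw : ∀ j, AwayFromPoles ε (a j) w) => hw j
  obtain ⟨C, hC, hO⟩ := hO.exists_pos
  rw [IsBigOWith, hl, eventually_inf_principal, eventually_rightHalfPlaneAtInfty] at hO
  obtain ⟨R, hR⟩ := hO
  have hbound : ∀ᶠ N : ℕ in atTop, ∀ y : ℝ,
      ‖mellinBarnesIntegrand D a b ((x + N : ℝ) + y * I)‖ ≤
        C * ‖((x + N : ℝ) + y * I : ℂ)‖ ^ e := by
    filter_upwards [tendsto_natCast_atTop_atTop.eventually (eventually_ge_atTop R)] with N hN y
    have h1 := abs_re_le_norm ((x + N : ℝ) + y * I : ℂ)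
    have h2 := le_abs_self ((x + N : ℝ) + y * I : ℂ).re
    have h3 : ((x + N : ℝ) + y * I : ℂ).re = x + N := by simp
    have := hR ((x + N : ℝ) + y * I) (by rw [h3]; positivity) (by linarith) (haway N y)
    rwa [Real.norm_of_nonneg (by positivity)] at this
  have := tendsto_integral_filter_of_dominated_convergence
    (F := fun (N : ℕ) (y : ℝ) => mellinBarnesIntegrand D a b ((x + N : ℝ) + y * I))
    (f := fun _ => 0) (μ := volume) (l := atTop)
    (fun y => C * ((2⁻¹ : ℝ) ^ e * (1 + ‖y‖) ^ e)) ?_ ?_ ?_ ?_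
  · simpa using this
  · refine Eventually.of_forall fun N =>
      (continuous_mellinBarnesIntegrand_line hb (by positivity)
        fun j k h => ha j ?_).aestronglyMeasurable
    rw [Real.sin_eq_zero_iff]
    refine ⟨(N : ℤ) - k, ?_⟩
    simp only [add_re, natCast_re] at h
    push_cast
    linear_combination π * h
  · filter_upwards [hbound, eventually_ge_atTop 1] with N hN hN1
    refine Eventually.of_forall fun y => (hN y).trans ?_
    gcongr
    have hN1 : (1 : ℝ) ≤ N := by exact_mod_cast hN1
    have h3 : ((x + N : ℝ) + y * I : ℂ).re = x + N := by simp
    have := norm_rpow_le_one_add_abs (e := e) (w := (x + N : ℝ) + y * I) (by linarith)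
      (Or.inl (by rw [h3]; exact (by linarith : 1 ≤ x + N).trans (le_abs_self _)))
    simpa using this
  · exact ((integrable_one_add_norm_rpow he).const_mul _).const_mul _
  · refine Eventually.of_forall fun y => ?_
    have hn : Tendsto (fun N : ℕ => ‖((x + N : ℝ) + y * I : ℂ)‖) atTop atTop := by
      refine tendsto_atTop_mono (fun N => ?_) tendsto_natCast_atTop_atTop
      refine le_trans ?_ (re_le_norm _)
      simpa using hx
    have h0 := ((tendsto_rpow_neg_atTop (y := -e) (by linarith)).comp hn).const_mul C
    rw [mul_zero, neg_neg] at h0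
    exact squeeze_zero_norm' (hbound.mono fun N h => h y) h0

end Integrand

/-! ### The residue series -/

section Residues

lemma exists_sin_ne_zero {ι : Type*} [Finite ι] (c : ι → ℝ) :
    ∃ x, 0 ≤ x ∧ ∀ j, Real.sin (π * (c j - x)) ≠ 0 := by
  have hcount : (⋃ j, range fun m : ℤ => c j - m).Countable :=
    countable_iUnion fun j => countable_range _
  obtain ⟨x, hx, hx0⟩ := (hcount.dense_compl ℝ).exists_mem_open isOpen_Ioi (nonempty_Ioi (a := 0))
  refine ⟨x, le_of_lt hx0, fun j h => hx ?_⟩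
  obtain ⟨m, hm⟩ := Real.sin_eq_zero_iff.1 h
  refine mem_iUnion.2 ⟨j, m, ?_⟩
  have := mul_left_cancel₀ Real.pi_ne_zero (show π * m = π * (c j - x) by rw [← hm, mul_comm])
  simp only [this]; ring

variable {ι : Type*} [Fintype ι] [DecidableEq ι] (D : ℂ) (a b : ι → ℂ)

/-- The `k`-th residue of `-mellinBarnesIntegrand D a b` in the `i`-th sequence of poles, at
`w = a i + k`. -/
noncomputable def mellinBarnesResidue (i : ι) (k : ℕ) : ℂ :=
  mellinBarnesResidueFactor D (a i) (b i) k *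
    ∏ j ∈ Finset.univ.erase i, mellinBarnesFactor D (a j) (b j) (a i + k)

lemma tendsto_mul_mellinBarnesFactor {D a b : ℂ} (ha : 0 < a.re) (hb : 0 < b.re) (k : ℕ) :
    Tendsto (fun w => (w - (a + k)) * mellinBarnesFactor D a b w) (𝓝[≠] (a + k))
      (𝓝 (-mellinBarnesResidueFactor D a b k)) := by
  have hu : Tendsto (fun w : ℂ => a + k - w) (𝓝[≠] (a + k)) (𝓝[≠] 0) := by
    refine tendsto_nhdsWithin_iff.2 ⟨?_, ?_⟩
    · have : Tendsto (fun w : ℂ => a + k - w) (𝓝 (a + k)) (𝓝 (a + k - (a + k))) :=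
        Continuous.tendsto (by fun_prop) _
      rw [sub_self] at this
      exact this.mono_left nhdsWithin_le_nhds
    · filter_upwards [self_mem_nhdsWithin] with w hw
      exact sub_ne_zero.2 (Ne.symm hw)
  have h2 := (tendsto_mul_Gamma_neg_nat_add k).comp hu
  have h1 : Tendsto (fun w => Gamma (b + w)) (𝓝[≠] (a + k)) (𝓝 (Gamma (b + (a + k)))) := by
    refine (ContinuousAt.tendsto ?_).mono_left nhdsWithin_le_nhds
    refine ContinuousAt.comp (f := fun w => b + w)
      (differentiableAt_Gamma _ fun m h => ?_).continuousAt (by fun_prop)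
    have := congrArg re h
    simp only [add_re, neg_re, natCast_re] at this
    have := Nat.cast_nonneg (α := ℝ) m
    have := Nat.cast_nonneg (α := ℝ) k
    linarith
  have hc := differentiable_one_div_Gamma.continuous
  have h3 : Tendsto (fun w => (Gamma (D - b - w))⁻¹) (𝓝[≠] (a + k))
      (𝓝 (Gamma (D - b - (a + k)))⁻¹) :=
    ((hc.comp (continuous_sub_left (D - b))).tendsto _).mono_left nhdsWithin_le_nhds
  have h4 : Tendsto (fun w => (Gamma (D - a + w))⁻¹) (𝓝[≠] (a + k))
      (𝓝 (Gamma (D - a + (a + k)))⁻¹) :=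
    ((hc.comp (continuous_const_add (D - a))).tendsto _).mono_left nhdsWithin_le_nhds
  refine (((h1.mul h2).mul h3).mul h4).neg.congr fun w => ?_
  simp only [Function.comp, mellinBarnesFactor]
  rw [show -(k : ℂ) + (a + k - w) = a - w by ring]
  ring

variable {D a b}

lemma tendsto_mul_mellinBarnesIntegrand (ha : ∀ j, 0 < (a j).re) (hb : ∀ j, 0 < (b j).re)
    (hab : ∀ i j, i ≠ j → ∀ m : ℤ, a i - a j ≠ m) (i : ι) (k : ℕ) :
    Tendsto (fun w => (w - (a i + k)) * mellinBarnesIntegrand D a b w) (𝓝[≠] (a i + k))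
      (𝓝 (-mellinBarnesResidue D a b i k)) := by
  rw [mellinBarnesResidue, ← neg_mul]
  refine ((tendsto_mul_mellinBarnesFactor (ha i) (hb i) k).mul (tendsto_finsetProd _
    fun j hj => ContinuousAt.tendsto (DifferentiableAt.continuousAt (𝕜 := ℂ)
      (differentiableAt_mellinBarnesFactor (hb j) ?_ fun m h => ?_))
        |>.mono_left nhdsWithin_le_nhds)).congr fun w => ?_
  · simpa using add_nonneg (ha i).le (Nat.cast_nonneg k)
  · refine hab i j (Finset.ne_of_mem_erase hj).symm (m - k) ?_
    push_cast
    linear_combination h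
  · rw [mul_assoc, Finset.mul_prod_erase _ (fun j => mellinBarnesFactor D (a j) (b j) w)
      (Finset.mem_univ i), mellinBarnesIntegrand]

theorem summable_mellinBarnesResidue (he : ∑ j, (2 * (a j + b j - D)).re < -1)
    (ha : ∀ j, 0 < (a j).re) (hab : ∀ i j, i ≠ j → ∀ m : ℤ, a i - a j ≠ m) (i : ι) :
    Summable fun k => ‖mellinBarnesResidue D a b i k‖ := by
  have ht := tendsto_add_natCast_rightHalfPlane (ha i)
  have hj : ∀ j ∈ Finset.univ.erase i, (fun k : ℕ => mellinBarnesFactor D (a j) (b j) (a i + k))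
      =O[atTop] fun k : ℕ => ‖a i + k‖ ^ (2 * (a j + b j - D)).re := by
    intro j hj
    have hs : 0 < ‖sin (π * (a j - a i))‖ := by
      rw [norm_pos_iff]
      intro h
      obtain ⟨m, hm⟩ := sin_eq_zero_iff.1 h
      refine hab j i (Finset.ne_of_mem_erase hj) m ?_
      have hpi : (π : ℂ) ≠ 0 := ofReal_ne_zero.2 Real.pi_ne_zero
      exact mul_left_cancel₀ hpi (by rw [hm, mul_comm])
    have hc := Real.cosh_pos (π * (a j - a i) : ℂ).im
    refine IsBigO.comp_tendsto (mellinBarnesFactor_isBigO D (a j) (b j)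
      (l := map (fun k : ℕ => a i + k) atTop) ht
      (ε := ‖sin (π * (a j - a i))‖ / Real.cosh (π * (a j - a i) : ℂ).im) (by positivity)
      (eventually_map.2 (Eventually.of_forall fun k => ?_))) tendsto_map
    rw [AwayFromPoles, show (π * (a j - (a i + k)) : ℂ) = π * (a j - a i) - k * π by ring,
      sin_antiperiodic.sub_nat_mul_eq, norm_mul, norm_pow, norm_neg, norm_one, one_pow, one_mul]
    rw [show ((π * (a j - a i) - k * π : ℂ)).im = (π * (a j - a i) : ℂ).im by simp,
      div_mul_cancel₀ _ hc.ne']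
  have hpos : ∀ᶠ k : ℕ in atTop, 0 < ‖a i + k‖ := ht.eventually eventually_norm_pos
  have hO : (fun k => mellinBarnesResidue D a b i k) =O[atTop]
      fun k : ℕ => (k : ℝ) ^ ∑ j, (2 * (a j + b j - D)).re := by
    have h1 := (mellinBarnesResidueFactor_isBigO D (a i) (b i) (ha i)).mul
      (prod_rpow_isBigO hpos hj)
    refine h1.trans (IsBigO.of_bound 1 ?_)
    filter_upwards [hpos, eventually_gt_atTop 0] with k hk hk0
    rw [← Real.rpow_add hk, Finset.add_sum_erase _ (fun j => (2 * (a j + b j - D)).re)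
      (Finset.mem_univ i), one_mul, Real.norm_of_nonneg (by positivity),
      Real.norm_of_nonneg (by positivity)]
    refine Real.rpow_le_rpow_of_nonpos (by exact_mod_cast hk0) ?_ (by linarith)
    refine le_trans ?_ (re_le_norm _)
    simpa using (ha i).le
  exact (summable_of_isBigO_nat (Real.summable_nat_rpow.2 he) hO.norm_left)

/-- **Residue theorem for the Mellin–Barnes integrand.** -/
theorem integral_mellinBarnesIntegrand (he : ∑ j, (2 * (a j + b j - D)).re < -1)
    (ha : ∀ j, 0 < (a j).re) (hb : ∀ j, 0 < (b j).re)
    (hab : ∀ i j, i ≠ j → ∀ m : ℤ, a i - a j ≠ m) :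
    ∫ y : ℝ, mellinBarnesIntegrand D a b (y * I) =
      2 * π * ∑ i, ∑' k, mellinBarnesResidue D a b i k := by
  obtain ⟨x, hx, hsin⟩ := exists_sin_ne_zero fun j => (a j).re
  have hne : ∀ (N : ℕ) j (k : ℕ), x + N ≠ (a j + k).re := by
    intro N j k h
    refine hsin j (Real.sin_eq_zero_iff.2 ⟨(N : ℤ) - k, ?_⟩)
    simp only [add_re, natCast_re] at h
    push_cast
    linear_combination π * h
  have hinj : ∀ p q : (_ : ι) × ℕ, a p.1 + p.2 = a q.1 + q.2 → p = q := by
    rintro ⟨i, k⟩ ⟨j, m⟩ h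
    simp only at h
    obtain rfl : i = j := by
      by_contra hij
      refine hab i j hij (m - k) ?_
      push_cast
      linear_combination h
    simpa using h
  have hzero : ∀ j (k : ℕ), (0 : ℝ) ≠ (a j + k).re := by
    intro j k h
    have := ha j
    simp only [add_re, natCast_re] at h
    have := Nat.cast_nonneg (α := ℝ) k
    linarith
  have key : ∀ N : ℕ, (∫ y : ℝ, mellinBarnesIntegrand D a b ((x + N : ℝ) + y * I)) -
      ∫ y : ℝ, mellinBarnesIntegrand D a b (y * I) =
      2 * π * -∑ i, ∑ k ∈ Finset.range ⌈x + N - (a i).re⌉₊, mellinBarnesResidue D a b i k := by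
    intro N
    set P : Finset ((_ : ι) × ℕ) :=
      Finset.univ.sigma fun i => Finset.range ⌈x + N - (a i).re⌉₊ with hP
    have hmem : ∀ p : (_ : ι) × ℕ, p ∈ P ↔ (a p.1 + p.2).re < x + N := by
      intro p
      simp only [hP, Finset.mem_sigma, Finset.mem_univ, true_and, Finset.mem_range, Nat.lt_ceil,
        add_re, natCast_re]
      constructor <;> intro h <;> linarith
    have := integral_line_sub_integral_line (f := mellinBarnesIntegrand D a b) (a := 0)
      (b := x + N) (by positivity) (S := P.image fun p => a p.1 + p.2)
      (r := fun q => limUnder (𝓝[≠] q) fun w => (w - q) * mellinBarnesIntegrand D a b w)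
      ?_ ?_ ?_ (tendsto_mellinBarnesIntegrand_stripAtInfty (by linarith) le_rfl)
      (integrable_mellinBarnesIntegrand_line he hb le_rfl hzero)
      (integrable_mellinBarnesIntegrand_line he hb (by positivity) (hne N))
    · rw [Finset.sum_image fun p _ q _ h => hinj p q h, hP, Finset.sum_sigma] at this
      simp only [ofReal_zero, zero_add] at this
      rw [this, ← Finset.sum_neg_distrib]
      simp only [← Finset.sum_neg_distrib]
      congr 1
      refine Finset.sum_congr rfl fun i _ => Finset.sum_congr rfl fun k _ => ?_
      exact (tendsto_mul_mellinBarnesIntegrand ha hb hab i k).limUnder_eq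
    · intro q hq
      obtain ⟨p, hp, rfl⟩ := Finset.mem_image.1 hq
      refine ⟨?_, (hmem p).1 hp⟩
      simpa using add_pos_of_pos_of_nonneg (ha p.1) (Nat.cast_nonneg p.2)
    · intro w hw0 hwN hw
      refine differentiableAt_mellinBarnesIntegrand hb hw0 fun j k h => ?_
      have hlt : (a j + k).re < x + N := lt_of_le_of_ne (h ▸ hwN) (hne N j k).symm
      exact hw (Finset.mem_image.2 ⟨⟨j, k⟩, (hmem _).2 hlt, h.symm⟩)
    · intro q hq
      obtain ⟨p, -, rfl⟩ := Finset.mem_image.1 hq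
      have := tendsto_mul_mellinBarnesIntegrand (D := D) ha hb hab p.1 p.2
      simpa only [this.limUnder_eq] using this
  have hlim : Tendsto (fun N : ℕ => 2 * π * -∑ i, ∑ k ∈ Finset.range ⌈x + N - (a i).re⌉₊,
      mellinBarnesResidue D a b i k) atTop
      (𝓝 (2 * π * -∑ i, ∑' k, mellinBarnesResidue D a b i k)) := by
    refine (tendsto_finsetSum _ fun i _ => ?_).neg.const_mul _
    refine (summable_mellinBarnesResidue he ha hab i).of_norm.hasSum.tendsto_sum_nat.comp ?_
    refine tendsto_nat_ceil_atTop.comp ?_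
    simp only [add_comm x, add_sub_assoc]
    exact tendsto_atTop_add_const_right _ _ tendsto_natCast_atTop_atTop
  have h1 := ((tendsto_integral_mellinBarnesIntegrand_line he hb hx hsin).sub_const
    (∫ y : ℝ, mellinBarnesIntegrand D a b (y * I))).congr key
  have := tendsto_nhds_unique h1 hlim
  linear_combination -this

end Residues

lemma ne_intCast_of_sub_natCast_ne {z : ℂ} (h : ∀ k j : ℕ, z - k ≠ -(j : ℂ)) (m : ℤ) :
    z ≠ m := by
  rintro rfl
  refine h m.toNat (-m).toNat ?_
  have := Int.toNat_sub_toNat_neg m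
  rw [sub_eq_iff_eq_add, neg_add_eq_sub]
  exact_mod_cast this.symm

end Helpers

/-- **Residue evaluation of the rank-`n` Mellin–Barnes integral.**
Under the pole-separation conditions, the decay condition `Re(α₂₃₅) > 1/2`,
and the assumption that no Gamma factor is evaluated at a pole on the contour
or at a summation point, the integral `∫_ℝ Fₙ(ν) dν` of the Mellin–Barnes
integrand equals `2π(S₁ⁿ + S₂ⁿ + S₃ⁿ)`, the sum of the residues in the upper
half-plane, the three series converging absolutely. -/
theorem stmt9 (d : ℝ) (hd : 0 < d) (n : ℕ) (α₁ α₂ α₃ α₄ α₅ : ℂ)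
    -- pole-separation conditions :
    (hp₁ : α₄.re - d / 4 + n / 2 > 0)
    (hp₂ : (α₁ + α₄ + α₅).re - 3 * d / 4 + n / 2 > 0)
    (hp₃ : d / 4 - α₃.re + n / 2 > 0)
    (hp₄ : d / 4 + (n : ℝ) / 2 > 0)
    (hp₅ : 3 * d / 4 - (α₄ + α₅).re + n / 2 > 0)
    (hp₆ : 5 * d / 4 - (α₁ + α₂ + α₄ + α₅).re + n / 2 > 0)
    -- decay condition :
    (hdec : (α₂ + α₃ + α₅).re > 1 / 2)
    -- the integrand Fₙ :
    (F : ℝ → ℂ)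
    (hF : ∀ ν : ℝ, F ν =
      (Gamma ((d : ℂ) / 4 + n / 2 - I * ν) / Gamma ((d : ℂ) / 4 + n / 2 + I * ν)) *
      (Gamma (α₄ - (d : ℂ) / 4 + n / 2 + I * ν) /
        Gamma (3 * (d : ℂ) / 4 - α₄ + n / 2 - I * ν)) *
      (Gamma (3 * (d : ℂ) / 4 - (α₄ + α₅) + n / 2 - I * ν) /
        Gamma ((α₄ + α₅) - (d : ℂ) / 4 + n / 2 + I * ν)) *
      (Gamma ((α₁ + α₄ + α₅) - 3 * (d : ℂ) / 4 + n / 2 + I * ν) /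
        Gamma (5 * (d : ℂ) / 4 - (α₁ + α₄ + α₅) + n / 2 - I * ν)) *
      (Gamma (5 * (d : ℂ) / 4 - (α₁ + α₂ + α₄ + α₅) + n / 2 - I * ν) /
        Gamma ((α₁ + α₂ + α₄ + α₅) - 3 * (d : ℂ) / 4 + n / 2 + I * ν)) *
      (Gamma ((d : ℂ) / 4 - α₃ + n / 2 + I * ν) /
        Gamma (α₃ + (d : ℂ) / 4 + n / 2 - I * ν)))
    -- no Gamma factor has a pole on the integration contour :
    (hnc : ∀ ν : ℝ, ∀ w ∈ [
        (d : ℂ) / 4 + n / 2 - I * ν, (d : ℂ) / 4 + n / 2 + I * ν,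
        α₄ - (d : ℂ) / 4 + n / 2 + I * ν, 3 * (d : ℂ) / 4 - α₄ + n / 2 - I * ν,
        3 * (d : ℂ) / 4 - (α₄ + α₅) + n / 2 - I * ν,
        (α₄ + α₅) - (d : ℂ) / 4 + n / 2 + I * ν,
        (α₁ + α₄ + α₅) - 3 * (d : ℂ) / 4 + n / 2 + I * ν,
        5 * (d : ℂ) / 4 - (α₁ + α₄ + α₅) + n / 2 - I * ν,
        5 * (d : ℂ) / 4 - (α₁ + α₂ + α₄ + α₅) + n / 2 - I * ν,
        (α₁ + α₂ + α₄ + α₅) - 3 * (d : ℂ) / 4 + n / 2 + I * ν,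
        (d : ℂ) / 4 - α₃ + n / 2 + I * ν,
        α₃ + (d : ℂ) / 4 + n / 2 - I * ν], ∀ j : ℕ, w ≠ -(j : ℂ))
    -- no Gamma factor has a pole at a summation point :
    (hns : ∀ k : ℕ, ∀ w ∈ [
        α₄ + n + k, (d : ℂ) / 2 - α₅ + n + k, (α₁ + α₅) - (d : ℂ) / 2 - k,
        (d : ℂ) - (α₁ + α₂ + α₅) + n + k, (d : ℂ) / 2 - (α₃ + α₄) - k,
        (d : ℂ) / 2 - α₄ - k, α₅ - k, (d : ℂ) - (α₁ + α₅) + n + k,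
        (α₁ + α₂ + α₅) - (d : ℂ) / 2 - k, (α₃ + α₄) + n + k, (d : ℂ) / 2 + n + k,
        (α₁ + α₄ + α₅) - (d : ℂ) / 2 + n + k, (d : ℂ) / 2 - (α₁ + α₅) - k,
        α₁ + n + k, (d : ℂ) / 2 - α₂ + n + k, (d : ℂ) - (α₁ + α₃ + α₄ + α₅) - k,
        (d : ℂ) - (α₁ + α₄ + α₅) - k, (α₁ + α₅) + n + k, (d : ℂ) / 2 - α₁ - k,
        α₂ - k, (α₁ + α₃ + α₄ + α₅) - (d : ℂ) / 2 + n + k,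
        (d : ℂ) / 2 - α₃ + n + k, (α₃ + α₄) - (d : ℂ) / 2 - k,
        (d : ℂ) - (α₃ + α₄ + α₅) + n + k, (α₁ + α₃ + α₄ + α₅) - (d : ℂ) - k,
        3 * (d : ℂ) / 2 - (α₁ + α₂ + α₃ + α₄ + α₅) + n + k, α₃ - k,
        (d : ℂ) - (α₃ + α₄) + n + k, (α₃ + α₄ + α₅) - (d : ℂ) / 2 - k,
        3 * (d : ℂ) / 2 - (α₁ + α₃ + α₄ + α₅) + n + k,
        (α₁ + α₂ + α₃ + α₄ + α₅) - (d : ℂ) - k], ∀ j : ℕ, w ≠ -(j : ℂ))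
    -- the residue series S₁ⁿ, S₂ⁿ, S₃ⁿ :
    (T₁ T₂ T₃ : ℕ → ℂ)
    (hT₁ : ∀ k : ℕ, T₁ k = (-1 : ℂ) ^ k / (k.factorial : ℂ) *
      (Gamma (α₄ + n + k) * Gamma ((d : ℂ) / 2 - α₅ + n + k) *
        Gamma ((α₁ + α₅) - (d : ℂ) / 2 - k) * Gamma ((d : ℂ) - (α₁ + α₂ + α₅) + n + k) *
        Gamma ((d : ℂ) / 2 - (α₃ + α₄) - k) /
      (Gamma ((d : ℂ) / 2 - α₄ - k) * Gamma (α₅ - k) * Gamma ((d : ℂ) - (α₁ + α₅) + n + k) *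
        Gamma ((α₁ + α₂ + α₅) - (d : ℂ) / 2 - k) * Gamma ((α₃ + α₄) + n + k) *
        Gamma ((d : ℂ) / 2 + n + k))))
    (hT₂ : ∀ k : ℕ, T₂ k = (-1 : ℂ) ^ k / (k.factorial : ℂ) *
      (Gamma ((α₁ + α₄ + α₅) - (d : ℂ) / 2 + n + k) * Gamma ((d : ℂ) / 2 - (α₁ + α₅) - k) *
        Gamma (α₁ + n + k) * Gamma ((d : ℂ) / 2 - α₂ + n + k) *
        Gamma ((d : ℂ) - (α₁ + α₃ + α₄ + α₅) - k) /
      (Gamma ((d : ℂ) - (α₁ + α₄ + α₅) - k) * Gamma ((α₁ + α₅) + n + k) *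
        Gamma ((d : ℂ) / 2 - α₁ - k) * Gamma (α₂ - k) *
        Gamma ((α₁ + α₃ + α₄ + α₅) - (d : ℂ) / 2 + n + k) * Gamma ((d : ℂ) / 2 + n + k))))
    (hT₃ : ∀ k : ℕ, T₃ k = (-1 : ℂ) ^ k / (k.factorial : ℂ) *
      (Gamma ((d : ℂ) / 2 - α₃ + n + k) * Gamma ((α₃ + α₄) - (d : ℂ) / 2 - k) *
        Gamma ((d : ℂ) - (α₃ + α₄ + α₅) + n + k) * Gamma ((α₁ + α₃ + α₄ + α₅) - (d : ℂ) - k) *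
        Gamma (3 * (d : ℂ) / 2 - (α₁ + α₂ + α₃ + α₄ + α₅) + n + k) /
      (Gamma (α₃ - k) * Gamma ((d : ℂ) - (α₃ + α₄) + n + k) *
        Gamma ((α₃ + α₄ + α₅) - (d : ℂ) / 2 - k) *
        Gamma (3 * (d : ℂ) / 2 - (α₁ + α₃ + α₄ + α₅) + n + k) *
        Gamma ((α₁ + α₂ + α₃ + α₄ + α₅) - (d : ℂ) - k) * Gamma ((d : ℂ) / 2 + n + k)))) :
    (Summable fun k : ℕ => ‖T₁ k‖) ∧ (Summable fun k : ℕ => ‖T₂ k‖) ∧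
    (Summable fun k : ℕ => ‖T₃ k‖) ∧ Integrable F volume ∧
    ∫ ν : ℝ, F ν = 2 * Real.pi * ((∑' k : ℕ, T₁ k) + (∑' k : ℕ, T₂ k) + (∑' k : ℕ, T₃ k)) := by
  set D : ℂ := (d : ℂ) / 2 + n with hD
  set a : Fin 3 → ℂ := ![α₄ - (d : ℂ) / 4 + n / 2, (α₁ + α₄ + α₅) - 3 * (d : ℂ) / 4 + n / 2,
    (d : ℂ) / 4 - α₃ + n / 2] with ha_def
  set b : Fin 3 → ℂ := ![(d : ℂ) / 4 + n / 2, 3 * (d : ℂ) / 4 - (α₄ + α₅) + n / 2,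
    5 * (d : ℂ) / 4 - (α₁ + α₂ + α₄ + α₅) + n / 2] with hb_def
  have h4 : ((d : ℂ) / 4).re = d / 4 := by exact_mod_cast ofReal_re (d / 4)
  have h34 : (3 * (d : ℂ) / 4).re = 3 * d / 4 := by exact_mod_cast ofReal_re (3 * d / 4)
  have h54 : (5 * (d : ℂ) / 4).re = 5 * d / 4 := by exact_mod_cast ofReal_re (5 * d / 4)
  have hn2 : ((n : ℂ) / 2).re = n / 2 := by simp
  have ha : ∀ j, 0 < (a j).re := by
    intro j
    fin_cases j
    · show 0 < (α₄ - (d : ℂ) / 4 + n / 2).re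
      rwa [add_re, sub_re, h4, hn2]
    · show 0 < ((α₁ + α₄ + α₅) - 3 * (d : ℂ) / 4 + n / 2).re
      rwa [add_re, sub_re, h34, hn2]
    · show 0 < ((d : ℂ) / 4 - α₃ + n / 2).re
      rwa [add_re, sub_re, h4, hn2]
  have hb : ∀ j, 0 < (b j).re := by
    intro j
    fin_cases j
    · show 0 < ((d : ℂ) / 4 + n / 2).re
      rwa [add_re, h4, hn2]
    · show 0 < (3 * (d : ℂ) / 4 - (α₄ + α₅) + n / 2).re
      rwa [add_re, sub_re, h34, hn2]
    · show 0 < (5 * (d : ℂ) / 4 - (α₁ + α₂ + α₄ + α₅) + n / 2).re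
      rwa [add_re, sub_re, h54, hn2]
  have he : ∑ j, (2 * (a j + b j - D)).re < -1 := by
    rw [← re_sum, show ∑ j, 2 * (a j + b j - D) = ((-2 : ℝ) : ℂ) * (α₂ + α₃ + α₅) by
      rw [Fin.sum_univ_three, hD]
      simp only [ha_def, hb_def, Matrix.cons_val]
      push_cast
      ring, re_ofReal_mul]
    linarith
  have h01 : ∀ m : ℤ, a 0 - a 1 ≠ m := ne_intCast_of_sub_natCast_ne fun k j => by
    rw [show a 0 - a 1 = (d : ℂ) / 2 - (α₁ + α₅) by
      simp only [ha_def, Matrix.cons_val]; ring]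
    exact hns k _ (by simp only [List.mem_cons, true_or, or_true]) j
  have h20 : ∀ m : ℤ, a 0 - a 2 ≠ m := ne_intCast_of_sub_natCast_ne fun k j => by
    rw [show a 0 - a 2 = (α₃ + α₄) - (d : ℂ) / 2 by
      simp only [ha_def, Matrix.cons_val]; ring]
    exact hns k _ (by simp only [List.mem_cons, true_or, or_true]) j
  have h12 : ∀ m : ℤ, a 1 - a 2 ≠ m := ne_intCast_of_sub_natCast_ne fun k j => by
    rw [show a 1 - a 2 = (α₁ + α₃ + α₄ + α₅) - (d : ℂ) by
      simp only [ha_def, Matrix.cons_val]; ring]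
    exact hns k _ (by simp only [List.mem_cons, true_or, or_true]) j
  have hswap : ∀ i j, (∀ m : ℤ, a i - a j ≠ m) → ∀ m : ℤ, a j - a i ≠ m := by
    intro i j h m hm
    refine h (-m) ?_
    push_cast
    linear_combination -hm
  have hab : ∀ i j, i ≠ j → ∀ m : ℤ, a i - a j ≠ m := by
    intro i j hij
    fin_cases i <;> fin_cases j
    · exact absurd rfl hij
    · exact h01
    · exact h20
    · exact hswap _ _ h01
    · exact absurd rfl hij
    · exact h12
    · exact hswap _ _ h20
    · exact hswap _ _ h12
    · exact absurd rfl hij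
  have hT₁' : T₁ = mellinBarnesResidue D a b 0 := by
    funext k
    rw [hT₁, mellinBarnesResidue, show (Finset.univ.erase 0 : Finset (Fin 3)) = {1, 2} by decide,
      Finset.prod_pair (by decide), hD]
    simp only [mellinBarnesResidueFactor, mellinBarnesFactor, ha_def, hb_def, Matrix.cons_val]
    ring_nf
  have hT₂' : T₂ = mellinBarnesResidue D a b 1 := by
    funext k
    rw [hT₂, mellinBarnesResidue, show (Finset.univ.erase 1 : Finset (Fin 3)) = {0, 2} by decide,
      Finset.prod_pair (by decide), hD]
    simp only [mellinBarnesResidueFactor, mellinBarnesFactor, ha_def, hb_def, Matrix.cons_val]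
    ring_nf
  have hT₃' : T₃ = mellinBarnesResidue D a b 2 := by
    funext k
    rw [hT₃, mellinBarnesResidue, show (Finset.univ.erase 2 : Finset (Fin 3)) = {0, 1} by decide,
      Finset.prod_pair (by decide), hD]
    simp only [mellinBarnesResidueFactor, mellinBarnesFactor, ha_def, hb_def, Matrix.cons_val]
    ring_nf
  have hF' : F = fun ν : ℝ => mellinBarnesIntegrand D a b ((-ν : ℝ) * I) := by
    funext ν
    rw [hF, mellinBarnesIntegrand, Fin.prod_univ_three, hD]
    simp only [mellinBarnesFactor, ha_def, hb_def, Matrix.cons_val]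
    push_cast
    ring_nf
  have hint : Integrable fun y : ℝ => mellinBarnesIntegrand D a b (y * I) := by
    have := integrable_mellinBarnesIntegrand_line (x := 0) he hb le_rfl fun j k h => by
      have := ha j
      simp only [add_re, natCast_re] at h
      linarith [Nat.cast_nonneg (α := ℝ) k]
    simpa only [ofReal_zero, zero_add] using this
  have hsum := summable_mellinBarnesResidue he ha hab
  refine ⟨hT₁' ▸ hsum 0, hT₂' ▸ hsum 1, hT₃' ▸ hsum 2, hF' ▸ hint.comp_neg, ?_⟩
  rw [hF', integral_neg_eq_self fun y : ℝ => mellinBarnesIntegrand D a b (y * I),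
    integral_mellinBarnesIntegrand he ha hb hab, Fin.sum_univ_three, hT₁', hT₂', hT₃']
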